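/- Suppose Condition (C) holds, a+b=1, and there exists N₀ > 0 such that ρ_k is nonincreasing in k for k ≥ N₀. If Σ_{n=2}^∞ 1/(D_Y(n) log n) < ∞, then almost surely the chain Y has at most finitely many cutpoints. If instead there exists δ > 0 such that D_Y(n) ≤ δ·n·log n for all sufficiently large n and Σ_{n=2}^∞ 1/(D_Y(n) log n) = ∞, then almost surely Y has infinitely many cutpoints. -/

import Mathlib

open Filter MeasureTheory ENNReal Topology

noncomputable section

/-- Transition function of the (1,2) random walk `Y`: from `1` jump to `0`, from `0`
jump to `2`, and from `n ≥ 2` jump to `n-1`, `n+1`, `n+2` with probabilities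
`q n`, `p1 n`, `p2 n` respectively. -/
def transY (q p1 p2 : ℕ → ℝ) (n j : ℕ) : ℝ :=
  if n = 0 then (if j = 2 then 1 else 0)
  else if n = 1 then (if j = 0 then 1 else 0)
  else if j = n - 1 then q n
  else if j = n + 1 then p1 n
  else if j = n + 2 then p2 n
  else 0

/-- `μ` is the law (on path space) of the time-homogeneous Markov chain on `ℕ`
with one-step transition probabilities `p` and initial state `init`. -/
def IsMarkovChain (μ : Measure (ℕ → ℕ)) (p : ℕ → ℕ → ℝ) (init : ℕ) : Prop :=
  μ {ω | ω 0 = init} = 1 ∧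
  ∀ (k : ℕ) (x : ℕ → ℕ) (j : ℕ),
    μ {ω | (∀ i ≤ k, ω i = x i) ∧ ω (k + 1) = j}
      = ENNReal.ofReal (p (x k) j) * μ {ω | ∀ i ≤ k, ω i = x i}

/-- `ρ_k`, the spectral radius of the matrix `A_k`. -/
def rho (q p1 p2 : ℕ → ℝ) (k : ℕ) : ℝ :=
  ((p1 k + p2 k) / q k
    + Real.sqrt (((p1 k + p2 k) / q k) ^ 2 + 4 * (p2 k / q k))) / 2

/-- `D_Y(n) = 1 + Σ_{j=n+1}^∞ Π_{i=n+1}^j ρ_i⁻¹`, valued in `ℝ≥0∞`. -/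
def DY (q p1 p2 : ℕ → ℝ) (n : ℕ) : ℝ≥0∞ :=
  1 + ∑' j : ℕ, ENNReal.ofReal (∏ i ∈ Finset.Icc (n + 1) (n + 1 + j), (rho q p1 p2 i)⁻¹)


/-! ### Part A: Markov chains on path space -/

lemma measurableSet_coord (n x : ℕ) : MeasurableSet {ω : ℕ → ℕ | ω n = x} := by
  have h : MeasurableSet ((fun ω : ℕ → ℕ => ω n) ⁻¹' {x}) :=
    measurable_pi_apply n (measurableSet_singleton x)
  exact h

def cyl (w : ℕ → ℕ) (t : ℕ) : Set (ℕ → ℕ) := {ω | ∀ i ≤ t, ω i = w i}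

lemma measurableSet_cyl (w : ℕ → ℕ) (t : ℕ) : MeasurableSet (cyl w t) := by
  have : cyl w t = ⋂ i, ⋂ (_ : i ≤ t), (fun ω : ℕ → ℕ => ω i) ⁻¹' {w i} := by
    ext ω; simp [cyl]
  rw [this]
  exact MeasurableSet.iInter fun i => MeasurableSet.iInter fun _ =>
    measurable_pi_apply i (measurableSet_singleton _)

lemma cyl_congr {w w' : ℕ → ℕ} {t : ℕ} (h : ∀ i ≤ t, w i = w' i) : cyl w t = cyl w' t := by
  ext ω
  simp only [cyl, Set.mem_ofPred_eq]
  exact forall₂_congr fun i hi => by rw [h i hi]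

lemma generateFrom_cyl :
    (inferInstance : MeasurableSpace (ℕ → ℕ)) =
      MeasurableSpace.generateFrom ({∅} ∪ {s | ∃ w t, s = cyl w t}) := by
  apply le_antisymm
  · refine iSup_le fun i => ?_
    rw [MeasurableSpace.comap_le_iff_le_map]
    intro s _
    show MeasurableSet[MeasurableSpace.generateFrom _] ((fun ω : ℕ → ℕ => ω i) ⁻¹' s)
    have : (fun ω : ℕ → ℕ => ω i) ⁻¹' s =
        ⋃ v : {v : Fin (i + 1) → ℕ // v (Fin.last i) ∈ s},
          cyl (fun n => if h : n < i + 1 then v.1 ⟨n, h⟩ else 0) i := by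
      ext ω
      simp only [Set.mem_preimage, Set.mem_iUnion, cyl, Set.mem_ofPred_eq]
      constructor
      · intro h
        refine ⟨⟨fun j => ω j, by simpa using h⟩, fun j hj => ?_⟩
        simp [Nat.lt_succ_of_le hj]
      · rintro ⟨⟨v, hv⟩, h⟩
        have := h i le_rfl
        simp at this
        rw [this]; exact hv
    rw [this]
    refine MeasurableSet.iUnion fun v => MeasurableSpace.measurableSet_generateFrom ?_
    exact Or.inr ⟨_, _, rfl⟩
  · refine MeasurableSpace.generateFrom_le ?_
    rintro s (hs | ⟨w, t, rfl⟩)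
    · rw [Set.mem_singleton_iff.1 hs]; exact MeasurableSet.empty
    · exact measurableSet_cyl w t

lemma isPiSystem_cyl : IsPiSystem (({∅} : Set (Set (ℕ → ℕ))) ∪ {s | ∃ w t, s = cyl w t}) := by
  rintro s hs u hu ⟨ω, hω1, hω2⟩
  rcases hs with hs | ⟨w, t, rfl⟩
  · rw [Set.mem_singleton_iff.1 hs] at hω1; exact hω1.elim
  rcases hu with hu | ⟨w', t', rfl⟩
  · rw [Set.mem_singleton_iff.1 hu] at hω2; exact hω2.elim
  refine Or.inr ⟨ω, max t t', ?_⟩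
  have h1 : cyl w t = cyl ω t := cyl_congr fun i hi => (hω1 i hi).symm
  have h2 : cyl w' t' = cyl ω t' := cyl_congr fun i hi => (hω2 i hi).symm
  rw [h1, h2]
  ext η
  simp only [cyl, Set.mem_inter_iff, Set.mem_ofPred_eq, le_max_iff]
  constructor
  · rintro ⟨a, b⟩ i (hi | hi)
    · exact a i hi
    · exact b i hi
  · intro h
    exact ⟨fun i hi => h i (Or.inl hi), fun i hi => h i (Or.inr hi)⟩

lemma cyl_succ (w : ℕ → ℕ) (k : ℕ) :
    cyl w (k + 1) = {ω | (∀ i ≤ k, ω i = w i) ∧ ω (k + 1) = w (k + 1)} := by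
  ext ω
  simp only [cyl, Set.mem_ofPred_eq]
  constructor
  · intro h
    exact ⟨fun i hi => h i (by omega), h _ le_rfl⟩
  · rintro ⟨h1, h2⟩ i hi
    rcases Nat.lt_or_ge k i with h | h
    · have : i = k + 1 := by omega
      rw [this]; exact h2
    · exact h1 i h

lemma markov_cyl_zero {μ : Measure (ℕ → ℕ)} [IsProbabilityMeasure μ] {p : ℕ → ℕ → ℝ} {x : ℕ}
    (h : IsMarkovChain μ p x) (w : ℕ → ℕ) :
    μ (cyl w 0) = if w 0 = x then 1 else 0 := by
  have e : cyl w 0 = {ω | ω 0 = w 0} := by ext ω; simp [cyl]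
  rw [e]
  split_ifs with hx
  · rw [hx]; exact h.1
  · have hm : MeasurableSet {ω : ℕ → ℕ | ω 0 = x} :=
      measurableSet_coord 0 x
    have := (prob_compl_eq_zero_iff hm).2 h.1
    refine measure_mono_null ?_ this
    intro ω hω hω'
    exact hx (hω.symm.trans hω')

lemma markov_unique {μ ν : Measure (ℕ → ℕ)} [IsProbabilityMeasure μ] [IsProbabilityMeasure ν]
    {p : ℕ → ℕ → ℝ} {x : ℕ}
    (h : IsMarkovChain μ p x) (h' : IsMarkovChain ν p x) : μ = ν := by
  refine MeasureTheory.ext_of_generate_finite _ generateFrom_cyl isPiSystem_cyl ?_ (by simp)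
  rintro s (hs | ⟨w, t, rfl⟩)
  · rw [Set.mem_singleton_iff.1 hs]; simp
  · induction t with
    | zero => rw [markov_cyl_zero h, markov_cyl_zero h']
    | succ k ih =>
      rw [cyl_succ, h.2, h'.2]
      unfold cyl at ih
      rw [ih]

def shiftMeasure (μ : Measure (ℕ → ℕ)) (w : ℕ → ℕ) (t : ℕ) : Measure (ℕ → ℕ) :=
  (μ (cyl w t))⁻¹ • (μ.restrict (cyl w t)).map (fun ω i => ω (t + i))

lemma measurable_shift (t : ℕ) : Measurable (fun (ω : ℕ → ℕ) i => ω (t + i)) :=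
  measurable_pi_lambda _ fun i => measurable_pi_apply _

lemma shiftMeasure_apply (μ : Measure (ℕ → ℕ)) (w : ℕ → ℕ) (t : ℕ) {A : Set (ℕ → ℕ)}
    (hA : MeasurableSet A) : shiftMeasure μ w t A =
      (μ (cyl w t))⁻¹ * μ ({ω | (fun i => ω (t + i)) ∈ A} ∩ cyl w t) := by
  rw [shiftMeasure, Measure.smul_apply, Measure.map_apply (measurable_shift t) hA,
    Measure.restrict_apply (measurable_shift t hA)]
  rfl

lemma shiftMeasure_prob (μ : Measure (ℕ → ℕ)) [IsProbabilityMeasure μ] (w : ℕ → ℕ) (t : ℕ)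
    (h0 : μ (cyl w t) ≠ 0) : IsProbabilityMeasure (shiftMeasure μ w t) := by
  constructor
  rw [shiftMeasure_apply _ _ _ MeasurableSet.univ]
  simp
  exact ENNReal.inv_mul_cancel h0 (measure_ne_top _ _)

lemma shiftMeasure_markov {μ : Measure (ℕ → ℕ)} [IsProbabilityMeasure μ] {p : ℕ → ℕ → ℝ} {x : ℕ}
    (h : IsMarkovChain μ p x) (w : ℕ → ℕ) (t : ℕ) (h0 : μ (cyl w t) ≠ 0) :
    IsMarkovChain (shiftMeasure μ w t) p (w t) := by
  constructor
  · rw [shiftMeasure_apply _ _ _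
      (measurableSet_coord 0 (w t))]
    have : {ω : ℕ → ℕ | (fun i => ω (t + i)) ∈ {ω : ℕ → ℕ | ω 0 = w t}} ∩ cyl w t = cyl w t := by
      apply Set.inter_eq_right.2
      intro ω hω
      exact hω t le_rfl
    rw [this]
    exact ENNReal.inv_mul_cancel h0 (measure_ne_top _ _)
  · intro k y j
    set z : ℕ → ℕ := fun i => if i ≤ t then w i else y (i - t) with hz
    have m1 : MeasurableSet {ω : ℕ → ℕ | (∀ i ≤ k, ω i = y i) ∧ ω (k + 1) = j} :=
      (measurableSet_cyl y k).inter (measurableSet_coord (k + 1) j)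
    have m2 : MeasurableSet {ω : ℕ → ℕ | ∀ i ≤ k, ω i = y i} := measurableSet_cyl y k
    rw [shiftMeasure_apply _ _ _ m1, shiftMeasure_apply _ _ _ m2]
    by_cases hy : y 0 = w t
    · have key : ∀ ω : ℕ → ℕ, ((∀ i ≤ k, ω (t + i) = y i) ∧ ∀ i ≤ t, ω i = w i) ↔
          ∀ i ≤ t + k, ω i = z i := by
        intro ω
        constructor
        · rintro ⟨h1, h2⟩ i hi
          by_cases hit : i ≤ t
          · simp [hz, hit, h2 i hit]
          · have := h1 (i - t) (by omega)
            rw [show t + (i - t) = i by omega] at this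
            simp [hz, hit, this]
        · intro h
          refine ⟨fun i hi => ?_, fun i hi => ?_⟩
          · rw [h (t + i) (by omega)]
            by_cases hi0 : i = 0
            · subst hi0; simp [hz, hy]
            · simp [hz, hi0]
          · rw [h i (by omega)]; simp [hz, hi]
      have e1 : {ω : ℕ → ℕ | (fun i => ω (t + i)) ∈
          {ω : ℕ → ℕ | (∀ i ≤ k, ω i = y i) ∧ ω (k + 1) = j}} ∩ cyl w t =
          {ω | (∀ i ≤ t + k, ω i = z i) ∧ ω (t + k + 1) = j} := by
        ext ω
        have := key ω
        simp only [cyl, Set.mem_inter_iff, Set.mem_ofPred_eq, ← add_assoc]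
        tauto
      have e2 : {ω : ℕ → ℕ | (fun i => ω (t + i)) ∈
          {ω : ℕ → ℕ | ∀ i ≤ k, ω i = y i}} ∩ cyl w t =
          {ω | ∀ i ≤ t + k, ω i = z i} := by
        ext ω
        have := key ω
        simp only [cyl, Set.mem_inter_iff, Set.mem_ofPred_eq]
        tauto
      rw [e1, e2, h.2]
      have : z (t + k) = y k := by
        by_cases hk : k = 0
        · subst hk; simp [hz, hy]
        · simp [hz, hk]
      rw [this]
      ring
    · have e1 : {ω : ℕ → ℕ | (fun i => ω (t + i)) ∈
          {ω : ℕ → ℕ | (∀ i ≤ k, ω i = y i) ∧ ω (k + 1) = j}} ∩ cyl w t = ∅ := by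
        ext ω
        simp only [cyl, Set.mem_inter_iff, Set.mem_ofPred_eq, Set.mem_empty_iff_false, iff_false]
        rintro ⟨⟨h1, _⟩, h2⟩
        exact hy ((h1 0 (by omega)).symm.trans (h2 t le_rfl))
      have e2 : {ω : ℕ → ℕ | (fun i => ω (t + i)) ∈
          {ω : ℕ → ℕ | ∀ i ≤ k, ω i = y i}} ∩ cyl w t = ∅ := by
        ext ω
        simp only [cyl, Set.mem_inter_iff, Set.mem_ofPred_eq, Set.mem_empty_iff_false, iff_false]
        rintro ⟨h1, h2⟩
        exact hy ((h1 0 (by omega)).symm.trans (h2 t le_rfl))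
      rw [e1, e2]; simp

/-- The family of laws of the chain started at each state. -/
def IsFamily (P : ℕ → Measure (ℕ → ℕ)) (p : ℕ → ℕ → ℝ) : Prop :=
  ∀ x, IsProbabilityMeasure (P x) ∧ IsMarkovChain (P x) p x

lemma family_markov {P : ℕ → Measure (ℕ → ℕ)} {p : ℕ → ℕ → ℝ} (hP : IsFamily P p) (x : ℕ)
    (w : ℕ → ℕ) (t : ℕ) {A : Set (ℕ → ℕ)} (hA : MeasurableSet A) :
    P x ({ω | (fun i => ω (t + i)) ∈ A} ∩ cyl w t) = P x (cyl w t) * P (w t) A := by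
  have := (hP x).1
  have := (hP (w t)).1
  by_cases h0 : P x (cyl w t) = 0
  · rw [h0, zero_mul]
    exact measure_mono_null Set.inter_subset_right h0
  · have := shiftMeasure_prob (P x) w t h0
    have := markov_unique (shiftMeasure_markov (hP x).2 w t h0) (hP (w t)).2
    rw [← this, shiftMeasure_apply _ _ _ hA, ← mul_assoc,
      ENNReal.mul_inv_cancel h0 (measure_ne_top _ _), one_mul]

lemma exists_step {μ : Measure (ℕ → ℕ)} [IsProbabilityMeasure μ] {p : ℕ → ℕ → ℝ} {x y : ℕ}
    (h : IsMarkovChain μ p x) (hp : 0 < p x y) :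
    ∃ ν : Measure (ℕ → ℕ), IsProbabilityMeasure ν ∧ IsMarkovChain ν p y := by
  set w : ℕ → ℕ := fun i => if i = 0 then x else y
  have h0 : μ (cyl w 1) ≠ 0 := by
    rw [cyl_succ, h.2]
    have : μ {ω | ∀ i ≤ 0, ω i = w i} = 1 := by
      have := markov_cyl_zero h w
      simpa [cyl, w] using this
    rw [this]
    simpa [w] using hp
  exact ⟨_, shiftMeasure_prob μ w 1 h0, shiftMeasure_markov h w 1 h0⟩

lemma exists_family (q p1 p2 : ℕ → ℝ)
    (hq : ∀ k, 2 ≤ k → 0 < q k) (hp2 : ∀ k, 2 ≤ k → 0 < p2 k)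
    (μ : Measure (ℕ → ℕ)) [IsProbabilityMeasure μ]
    (hμ : IsMarkovChain μ (transY q p1 p2) 2) :
    ∃ P, IsFamily P (transY q p1 p2) ∧ P 2 = μ := by
  have up : ∀ n, ∃ ν : Measure (ℕ → ℕ), IsProbabilityMeasure ν ∧
      IsMarkovChain ν (transY q p1 p2) (n + 2) := by
    intro n
    induction n with
    | zero => exact ⟨μ, inferInstance, hμ⟩
    | succ n ih =>
      obtain ⟨ν, i1, h1⟩ := ih
      obtain ⟨ν', i2, h2⟩ := exists_step (y := n + 4) h1 (by
        have := hp2 (n + 2) (by omega)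
        simpa [transY] using this)
      obtain ⟨ν'', i3, h3⟩ := exists_step (y := n + 3) h2 (by
        have := hq (n + 4) (by omega)
        simpa [transY] using this)
      exact ⟨ν'', i3, h3⟩
  have all : ∀ n, ∃ ν : Measure (ℕ → ℕ), IsProbabilityMeasure ν ∧
      IsMarkovChain ν (transY q p1 p2) n := by
    have h1 : ∃ ν : Measure (ℕ → ℕ), IsProbabilityMeasure ν ∧
      IsMarkovChain ν (transY q p1 p2) 1 := exists_step hμ (by
        have := hq 2 le_rfl
        simpa [transY] using this)
    intro n
    rcases n with _ | _ | n
    · obtain ⟨ν, i, h⟩ := h1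
      exact exists_step h (by simp [transY])
    · exact h1
    · exact up n
  choose P hP using all
  refine ⟨P, hP, ?_⟩
  have := (hP 2).1
  exact markov_unique (hP 2).2 hμ

/-- One-step decomposition. -/
lemma family_one_step {P : ℕ → Measure (ℕ → ℕ)} {p : ℕ → ℕ → ℝ} (hP : IsFamily P p) (x : ℕ)
    {A B : Set (ℕ → ℕ)} (hA : MeasurableSet A)
    (hAB : ∀ ω : ℕ → ℕ, ω 0 = x → (ω ∈ B ↔ (fun i => ω (1 + i)) ∈ A)) :
    P x B = ∑' z, ENNReal.ofReal (p x z) * P z A := by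
  have := (hP x).1
  set A' : Set (ℕ → ℕ) := {ω | (fun i => ω (1 + i)) ∈ A} with hA'
  have hA'm : MeasurableSet A' := measurable_shift 1 hA
  have hm0 : MeasurableSet {ω : ℕ → ℕ | ω 0 = x} :=
      measurableSet_coord 0 x
  have hx0 : P x ({ω : ℕ → ℕ | ω 0 = x}ᶜ) = 0 := (prob_compl_eq_zero_iff hm0).2 (hP x).2.1
  have e1 : P x B = P x (A' ∩ {ω : ℕ → ℕ | ω 0 = x}) := by
    apply measure_congr
    have : ∀ᵐ ω ∂(P x), ω 0 = x := hx0
    filter_upwards [this] with ω hω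
    apply propext
    have h1 := hAB ω hω
    constructor
    · intro h; exact ⟨h1.1 h, hω⟩
    · intro h; exact h1.2 h.1
  have e2 : A' ∩ {ω : ℕ → ℕ | ω 0 = x} =
      ⋃ z, A' ∩ cyl (fun i => if i = 0 then x else z) 1 := by
    ext ω
    simp only [Set.mem_inter_iff, Set.mem_iUnion, cyl, Set.mem_ofPred_eq]
    constructor
    · rintro ⟨h1, h2⟩
      refine ⟨ω 1, h1, fun i hi => ?_⟩
      rcases i with _ | _ | i
      · simpa using h2
      · simp
      · omega
    · rintro ⟨z, h1, h2⟩
      exact ⟨h1, by simpa using h2 0 (by omega)⟩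
  rw [e1, e2, measure_iUnion]
  · refine tsum_congr fun z => ?_
    have := family_markov hP x (fun i => if i = 0 then x else z) 1 hA
    rw [this, cyl_succ, (hP x).2.2]
    have h2 : P x {ω | ∀ i ≤ 0, ω i = if i = 0 then x else z} = 1 := by
      have := markov_cyl_zero (hP x).2 (fun i => if i = 0 then x else z)
      simpa [cyl] using this
    rw [h2]
    simp
  · intro z z' hzz
    refine Set.disjoint_left.2 ?_
    rintro ω ⟨_, h1⟩ ⟨_, h2⟩
    have a1 := h1 1 le_rfl
    have a2 := h2 1 le_rfl
    simp at a1 a2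
    exact hzz (a1.symm.trans a2)
  · intro z
    exact hA'm.inter (measurableSet_cyl _ _)


/-! ### Part B: first-step analysis and maximum principles -/

structure Chain (q p1 p2 : ℕ → ℝ) (P : ℕ → Measure (ℕ → ℕ)) : Prop where
  hq : ∀ k, 2 ≤ k → 0 < q k
  hp1 : ∀ k, 2 ≤ k → 0 ≤ p1 k
  hp2 : ∀ k, 2 ≤ k → 0 < p2 k
  hsum : ∀ k, 2 ≤ k → q k + p1 k + p2 k = 1
  fam : IsFamily P (transY q p1 p2)

/-- The event that the path avoids `S` and visits every point of `V`. -/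
def ev (S V : Set ℕ) : Set (ℕ → ℕ) := {ω | (∀ n, ω n ∉ S) ∧ ∀ i ∈ V, ∃ n, ω n = i}

lemma measurableSet_ev (S V : Set ℕ) : MeasurableSet (ev S V) := by
  have : ev S V = (⋂ n, ⋂ s, ⋂ (_ : s ∈ S), {ω : ℕ → ℕ | ω n = s}ᶜ) ∩
      ⋂ i, ⋂ (_ : i ∈ V), ⋃ n, {ω : ℕ → ℕ | ω n = i} := by
    ext ω
    simp only [ev, Set.mem_ofPred_eq, Set.mem_inter_iff, Set.mem_iInter, Set.mem_iUnion,
      Set.mem_compl_iff]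
    constructor
    · rintro ⟨h1, h2⟩
      exact ⟨fun n s hs h => h1 n (h ▸ hs), h2⟩
    · rintro ⟨h1, h2⟩
      exact ⟨fun n h => h1 n _ h rfl, h2⟩
  rw [this]
  refine MeasurableSet.inter ?_ ?_
  · exact MeasurableSet.iInter fun n => MeasurableSet.iInter fun s => MeasurableSet.iInter fun _ =>
      (measurableSet_coord n s).compl
  · exact MeasurableSet.iInter fun n => MeasurableSet.iInter fun s => MeasurableSet.iUnion fun _ =>
      (measurableSet_coord _ _)

lemma ev_step {S V : Set ℕ} {x : ℕ} (hS : x ∉ S) (hV : x ∉ V) (ω : ℕ → ℕ) (h0 : ω 0 = x) :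
    ω ∈ ev S V ↔ (fun i => ω (1 + i)) ∈ ev S V := by
  simp only [ev, Set.mem_ofPred_eq]
  constructor
  · rintro ⟨h1, h2⟩
    refine ⟨fun n => h1 _, fun i hi => ?_⟩
    obtain ⟨n, hn⟩ := h2 i hi
    rcases n with _ | n
    · exfalso; apply hV; rw [← h0, hn]; exact hi
    · exact ⟨n, by rw [add_comm]; exact hn⟩
  · rintro ⟨h1, h2⟩
    refine ⟨fun n => ?_, fun i hi => ?_⟩
    · rcases n with _ | n
      · rw [h0]; exact hS
      · have := h1 n
        rwa [add_comm] at this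
    · obtain ⟨n, hn⟩ := h2 i hi
      exact ⟨1 + n, hn⟩

section
variable {q p1 p2 : ℕ → ℝ} {P : ℕ → Measure (ℕ → ℕ)}

lemma Chain.prob (h : Chain q p1 p2 P) (x : ℕ) : IsProbabilityMeasure (P x) := (h.fam x).1

lemma Chain.step2 (h : Chain q p1 p2 P) {y : ℕ} (hy : 2 ≤ y) {A B : Set (ℕ → ℕ)}
    (hA : MeasurableSet A)
    (hAB : ∀ ω : ℕ → ℕ, ω 0 = y → (ω ∈ B ↔ (fun i => ω (1 + i)) ∈ A)) :
    (P y).real B = q y * (P (y - 1)).real A + p1 y * (P (y + 1)).real A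
      + p2 y * (P (y + 2)).real A := by
  have := h.prob (y - 1)
  have := h.prob (y + 1)
  have := h.prob (y + 2)
  have e := family_one_step h.fam y hA hAB
  have e2 : ∑' z, ENNReal.ofReal (transY q p1 p2 y z) * P z A =
      ∑ z ∈ {y - 1, y + 1, y + 2}, ENNReal.ofReal (transY q p1 p2 y z) * P z A := by
    refine tsum_eq_sum fun z hz => ?_
    simp only [Finset.mem_insert, Finset.mem_singleton, not_or] at hz
    have : transY q p1 p2 y z = 0 := by
      simp [transY, hz, show y ≠ 0 by omega, show y ≠ 1 by omega]
    simp [this]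
  have t1 : transY q p1 p2 y (y - 1) = q y := by
    simp [transY, show y ≠ 0 by omega, show y ≠ 1 by omega]
  have t2 : transY q p1 p2 y (y + 1) = p1 y := by
    simp [transY, show y ≠ 0 by omega, show y ≠ 1 by omega, show y + 1 ≠ y - 1 by omega]
  have t3 : transY q p1 p2 y (y + 2) = p2 y := by
    simp [transY, show y ≠ 0 by omega, show y ≠ 1 by omega, show y + 2 ≠ y - 1 by omega]
  rw [Finset.sum_insert (by simp; omega), Finset.sum_insert (by simp), Finset.sum_singleton,
    t1, t2, t3] at e2
  rw [measureReal_def, e, e2, ENNReal.toReal_add, ENNReal.toReal_add, ENNReal.toReal_mul,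
    ENNReal.toReal_mul, ENNReal.toReal_mul, ENNReal.toReal_ofReal (h.hq y hy).le,
    ENNReal.toReal_ofReal (h.hp1 y hy), ENNReal.toReal_ofReal (h.hp2 y hy).le]
  · simp only [measureReal_def]; ring
  all_goals finiteness

lemma Chain.step0 (h : Chain q p1 p2 P) {A B : Set (ℕ → ℕ)}
    (hA : MeasurableSet A)
    (hAB : ∀ ω : ℕ → ℕ, ω 0 = 0 → (ω ∈ B ↔ (fun i => ω (1 + i)) ∈ A)) :
    (P 0).real B = (P 2).real A := by
  have e := family_one_step h.fam 0 hA hAB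
  rw [tsum_eq_single 2] at e
  · simp [transY] at e
    simp [measureReal_def, e]
  · intro z hz
    simp [transY, hz]

lemma Chain.step1 (h : Chain q p1 p2 P) {A B : Set (ℕ → ℕ)}
    (hA : MeasurableSet A)
    (hAB : ∀ ω : ℕ → ℕ, ω 0 = 1 → (ω ∈ B ↔ (fun i => ω (1 + i)) ∈ A)) :
    (P 1).real B = (P 0).real A := by
  have e := family_one_step h.fam 1 hA hAB
  rw [tsum_eq_single 0] at e
  · simp [transY] at e
    simp [measureReal_def, e]
  · intro z hz
    simp [transY, hz]

lemma Chain.start (h : Chain q p1 p2 P) (x : ℕ) : ∀ᵐ ω ∂(P x), ω 0 = x := by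
  have := h.prob x
  exact (prob_compl_eq_zero_iff (measurableSet_coord 0 x)).2 (h.fam x).2.1

lemma Chain.ev_zero (h : Chain q p1 p2 P) {S V : Set ℕ} {x : ℕ} (hx : x ∈ S) :
    (P x).real (ev S V) = 0 := by
  have := h.prob x
  have h2 : P x (ev S V) = 0 := by
    have h3 : ∀ᵐ ω ∂(P x), ω ∉ ev S V := by
      filter_upwards [h.start x] with ω hω hev
      exact hev.1 0 (hω ▸ hx)
    rw [ae_iff] at h3
    simpa using h3
  simp [measureReal_def, h2]

/-- Averaging operator. -/
def avg (q p1 p2 : ℕ → ℝ) (v : ℕ → ℝ) (y : ℕ) : ℝ :=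
  q y * v (y - 1) + p1 y * v (y + 1) + p2 y * v (y + 2)

lemma Chain.ev_harm (h : Chain q p1 p2 P) {S V : Set ℕ} {x : ℕ} (hx2 : 2 ≤ x) (hS : x ∉ S)
    (hV : x ∉ V) :
    (P x).real (ev S V) = avg q p1 p2 (fun x => (P x).real (ev S V)) x :=
  h.step2 hx2 (measurableSet_ev S V) (ev_step hS hV)

lemma Chain.ev_harm0 (h : Chain q p1 p2 P) {S V : Set ℕ} (hS : 0 ∉ S)
    (hV : 0 ∉ V) :
    (P 0).real (ev S V) = (P 2).real (ev S V) :=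
  h.step0 (measurableSet_ev S V) (ev_step hS hV)

lemma Chain.ev_harm1 (h : Chain q p1 p2 P) {S V : Set ℕ} (hS : 1 ∉ S)
    (hV : 1 ∉ V) :
    (P 1).real (ev S V) = (P 0).real (ev S V) :=
  h.step1 (measurableSet_ev S V) (ev_step hS hV)

lemma Chain.max1 (h : Chain q p1 p2 P) {k N : ℕ} (hk : 1 ≤ k) {v : ℕ → ℝ}
    (hv : ∀ y, k < y → y < N → v y ≤ avg q p1 p2 v y)
    (h1 : v k ≤ 0) (h2 : v N ≤ 0) (h3 : v (N + 1) ≤ 0) :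
    ∀ y, k ≤ y → y ≤ N + 1 → v y ≤ 0 := by
  by_contra! hcon
  obtain ⟨y0, hy0k, hy0N, hy0⟩ := hcon
  obtain ⟨m, hm, hmax⟩ := Finset.exists_max_image (Finset.Icc k (N + 1)) v
    ⟨y0, Finset.mem_Icc.2 ⟨hy0k, hy0N⟩⟩
  have hex : ∃ y, k ≤ y ∧ y ≤ N + 1 ∧ v y = v m :=
    ⟨m, (Finset.mem_Icc.1 hm).1, (Finset.mem_Icc.1 hm).2, rfl⟩
  classical
  obtain ⟨ha, hb, hc⟩ := Nat.find_spec hex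
  set y := Nat.find hex with hy
  have hmpos : 0 < v m := hy0.trans_le (hmax y0 (Finset.mem_Icc.2 ⟨hy0k, hy0N⟩))
  have n1 : y ≠ k := by intro e; rw [e] at hc; linarith
  have n2 : y ≠ N := by intro e; rw [e] at hc; linarith
  have n3 : y ≠ N + 1 := by intro e; rw [e] at hc; linarith
  have hlt : v (y - 1) < v m := by
    refine lt_of_le_of_ne (hmax _ (Finset.mem_Icc.2 ⟨by omega, by omega⟩)) fun e => ?_
    have := Nat.find_min hex (m := y - 1) (by omega)
    exact this ⟨by omega, by omega, e⟩
  have hle1 : v (y + 1) ≤ v m := hmax _ (Finset.mem_Icc.2 ⟨by omega, by omega⟩)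
  have hle2 : v (y + 2) ≤ v m := hmax _ (Finset.mem_Icc.2 ⟨by omega, by omega⟩)
  have hh := hv y (by omega) (by omega)
  unfold avg at hh
  have e1 := h.hsum y (by omega)
  have e2 := h.hq y (by omega)
  have e3 := h.hp1 y (by omega)
  have e4 := (h.hp2 y (by omega)).le
  have g1 := mul_lt_mul_of_pos_left hlt e2
  have g2 := mul_le_mul_of_nonneg_left hle1 e3
  have g3 := mul_le_mul_of_nonneg_left hle2 e4
  have g4 : v m = q y * v m + p1 y * v m + p2 y * v m := by rw [← add_mul, ← add_mul, e1, one_mul]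
  linarith

lemma Chain.max2 (h : Chain q p1 p2 P) {k : ℕ} (hk : 2 ≤ k) {v : ℕ → ℝ} {B : ℝ}
    (hv0 : v 0 ≤ v 2) (hv1 : v 1 ≤ v 0)
    (hv : ∀ y, 2 ≤ y → y < k → v y ≤ avg q p1 p2 v y)
    (h1 : v k ≤ B) (h2 : v (k + 1) ≤ B) :
    ∀ y, y ≤ k + 1 → v y ≤ B := by
  by_contra! hcon
  obtain ⟨y0, hy0k, hy0⟩ := hcon
  obtain ⟨m, hm, hmax⟩ := Finset.exists_max_image (Finset.range (k + 2)) v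
    ⟨y0, Finset.mem_range.2 (by omega)⟩
  have hBm : B < v m := hy0.trans_le (hmax y0 (Finset.mem_range.2 (by omega)))
  set S := (Finset.range (k + 2)).filter (fun y => v y = v m) with hS
  have hSne : S.Nonempty := ⟨m, by simp [hS]; exact Finset.mem_range.1 hm⟩
  have hymem := S.max'_mem hSne
  set y := S.max' hSne with hy
  have hymax : ∀ z ∈ S, z ≤ y := fun z hz => S.le_max' z hz
  simp only [hS, Finset.mem_filter, Finset.mem_range] at hymem hymax
  obtain ⟨hyk, hyv⟩ := hymem
  have n1 : y ≠ k := by intro e; rw [e] at hyv; linarith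
  have n2 : y ≠ k + 1 := by intro e; rw [e] at hyv; linarith
  have hstrict : ∀ z, y < z → z < k + 2 → v z < v m := by
    intro z hz hzk
    refine lt_of_le_of_ne (hmax _ (Finset.mem_range.2 hzk)) fun e => ?_
    have := hymax z ⟨hzk, e⟩
    omega
  have h02 : y = 0 → False := by
    intro e
    have := hstrict 2 (by omega) (by omega)
    rw [e] at hyv
    linarith
  rcases Nat.lt_or_ge y 2 with hy2 | hy2
  · have : y = 0 ∨ y = 1 := by omega
    rcases this with e | e
    · exact h02 e
    · have := hstrict 2 (by omega) (by omega)
      rw [e] at hyv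
      linarith
  · have hlt := hstrict (y + 2) (by omega) (by omega)
    have hle1 : v (y + 1) ≤ v m := hmax _ (Finset.mem_range.2 (by omega))
    have hle2 : v (y - 1) ≤ v m := hmax _ (Finset.mem_range.2 (by omega))
    have hh := hv y (by omega) (by omega)
    unfold avg at hh
    have e1 := h.hsum y (by omega)
    have e2 := (h.hq y (by omega)).le
    have e3 := h.hp1 y (by omega)
    have e4 := (h.hp2 y (by omega))
    have g1 := mul_le_mul_of_nonneg_left hle2 e2
    have g2 := mul_le_mul_of_nonneg_left hle1 e3
    have g3 := mul_lt_mul_of_pos_left hlt e4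
    have g4 : v m = q y * v m + p1 y * v m + p2 y * v m := by
      rw [← add_mul, ← add_mul, e1, one_mul]
    linarith

lemma Chain.avg_sum (h : Chain q p1 p2 P) {k y : ℕ} (hk : 1 ≤ k) (hy : k < y) (d : ℕ → ℝ) :
    avg q p1 p2 (fun y => ∑ i ∈ Finset.Ico k y, d i) y =
      ∑ i ∈ Finset.Ico k y, d i
        - (q y * d (y - 1) - (p1 y + p2 y) * d y - p2 y * d (y + 1)) := by
  obtain ⟨z, rfl⟩ : ∃ z, y = z + 1 := ⟨y - 1, by omega⟩
  have e1 := h.hsum (z + 1) (by omega)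
  simp only [avg, Nat.add_sub_cancel]
  rw [Finset.sum_Ico_succ_top (show k ≤ z + 1 + 1 by omega),
    Finset.sum_Ico_succ_top (show k ≤ z + 1 by omega),
    Finset.sum_Ico_succ_top (show k ≤ z by omega)]
  have : q (z + 1) = 1 - p1 (z + 1) - p2 (z + 1) := by linarith
  rw [this]; ring

lemma avg_comb (q p1 p2 : ℕ → ℝ) (v w : ℕ → ℝ) (a b : ℝ) (y : ℕ) :
    avg q p1 p2 (fun y => v y * a - b * w y) y = avg q p1 p2 v y * a - b * avg q p1 p2 w y := by
  simp only [avg]; ring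

lemma Chain.gambler_up (h : Chain q p1 p2 P) {k N : ℕ} (hk : 1 ≤ k) (hkN : k < N)
    {d w : ℕ → ℝ} {M : ℝ} (hM : 0 ≤ M)
    (hd0 : ∀ i, k ≤ i → 0 < d i)
    (hd : ∀ y, k < y → y < N → (p1 y + p2 y) * d y + p2 y * d (y + 1) ≤ q y * d (y - 1))
    (hw : ∀ y, k < y → y < N → w y ≤ avg q p1 p2 w y)
    (h1 : w k ≤ 0) (h2 : w N ≤ M) (h3 : w (N + 1) ≤ M) :
    w (k + 1) ≤ M * (d k / ∑ i ∈ Finset.Ico k N, d i) := by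
  have hpos : 0 < ∑ i ∈ Finset.Ico k N, d i :=
    Finset.sum_pos (fun i hi => hd0 i (Finset.mem_Ico.1 hi).1) ⟨k, by simp [hkN]⟩
  set G := ∑ i ∈ Finset.Ico k N, d i with hG
  have := h.max1 (k := k) (N := N) hk
    (v := fun y => w y * G - M * ∑ i ∈ Finset.Ico k y, d i) ?_ ?_ ?_ ?_ (k + 1)
    (by omega) (by omega)
  · simp at this
    rw [← mul_div_assoc, le_div_iff₀ hpos]
    linarith
  · intro y hy hyN
    rw [avg_comb, h.avg_sum hk hy]
    have a1 := hd y hy hyN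
    have a2 := mul_le_mul_of_nonneg_right (hw y hy hyN) hpos.le
    have a3 := mul_le_mul_of_nonneg_left (show
      ∑ i ∈ Finset.Ico k y, d i
        - (q y * d (y - 1) - (p1 y + p2 y) * d y - p2 y * d (y + 1))
        ≤ ∑ i ∈ Finset.Ico k y, d i by linarith) hM
    linarith
  · simp
    exact mul_nonpos_of_nonpos_of_nonneg h1 hpos.le
  · have := mul_le_mul_of_nonneg_right h2 hpos.le
    simp only [← hG]; linarith
  · have := mul_le_mul_of_nonneg_right h3 hpos.le
    rw [Finset.sum_Ico_succ_top hkN.le, ← hG]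
    have := mul_nonneg hM (hd0 N hkN.le).le
    linarith

lemma Chain.gambler_low (h : Chain q p1 p2 P) {k N : ℕ} (hk : 1 ≤ k) (hkN : k < N)
    {d w : ℕ → ℝ} {M : ℝ} (hM : 0 ≤ M)
    (hd0 : ∀ i, k ≤ i → 0 < d i)
    (hd : ∀ y, k < y → y < N → q y * d (y - 1) ≤ (p1 y + p2 y) * d y + p2 y * d (y + 1))
    (hw : ∀ y, k < y → y < N → avg q p1 p2 w y ≤ w y)
    (h1 : 0 ≤ w k) (h2 : M ≤ w N) (h3 : M ≤ w (N + 1)) :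
    M * (d k / ∑ i ∈ Finset.Ico k (N + 1), d i) ≤ w (k + 1) := by
  have hpos : 0 < ∑ i ∈ Finset.Ico k (N + 1), d i :=
    Finset.sum_pos (fun i hi => hd0 i (Finset.mem_Ico.1 hi).1) ⟨k, by simp; omega⟩
  set G := ∑ i ∈ Finset.Ico k (N + 1), d i with hG
  have := h.max1 (k := k) (N := N) hk
    (v := fun y => (∑ i ∈ Finset.Ico k y, d i) * M - G * w y) ?_ ?_ ?_ ?_ (k + 1)
    (by omega) (by omega)
  · simp at this
    rw [← mul_div_assoc, div_le_iff₀ hpos]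
    linarith
  · intro y hy hyN
    rw [avg_comb, h.avg_sum hk hy]
    have a1 := hd y hy hyN
    have a2 := mul_le_mul_of_nonneg_left (hw y hy hyN) hpos.le
    have a3 := mul_le_mul_of_nonneg_right (show
      ∑ i ∈ Finset.Ico k y, d i ≤ ∑ i ∈ Finset.Ico k y, d i
        - (q y * d (y - 1) - (p1 y + p2 y) * d y - p2 y * d (y + 1))
        by linarith) hM
    linarith
  · simp
    exact mul_nonneg hpos.le h1
  · have := mul_le_mul_of_nonneg_left h2 hpos.le
    have e : G = ∑ i ∈ Finset.Ico k N, d i + d N := by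
      rw [hG, Finset.sum_Ico_succ_top hkN.le]
    have := mul_nonneg (hd0 N hkN.le).le hM
    have e2 : (∑ i ∈ Finset.Ico k N, d i) = G - d N := by linarith
    rw [e2]
    linarith
  · have := mul_le_mul_of_nonneg_left h3 hpos.le
    simp only [← hG]
    linarith
end


/-! ### Part C: estimates for avoiding probabilities -/

structure Good (q p1 p2 : ℕ → ℝ) (P : ℕ → Measure (ℕ → ℕ)) (K : ℕ) (c : ℝ) : Prop
    extends Chain q p1 p2 P where
  hK : 2 ≤ K
  hc : 0 < c
  hrho1 : ∀ n, K ≤ n → 1 ≤ rho q p1 p2 n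
  hrho2 : ∀ n, K ≤ n → rho q p1 p2 n ≤ 2
  hmono : ∀ n, K ≤ n → rho q p1 p2 (n + 1) ≤ rho q p1 p2 n
  hb : ∀ n, K ≤ n → p2 n ≤ q n
  hcq : ∀ n, K ≤ n → c ≤ q n
  hcp : ∀ n, K ≤ n → c ≤ p2 n

/-- partial products of inverse spectral radii -/
def ppi (q p1 p2 : ℕ → ℝ) (K n : ℕ) : ℝ := ∏ i ∈ Finset.Ioc K n, (rho q p1 p2 i)⁻¹

section
variable {q p1 p2 : ℕ → ℝ} {P : ℕ → Measure (ℕ → ℕ)} {K : ℕ} {c : ℝ}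

lemma Good.c_le (h : Good q p1 p2 P K c) : c ≤ 1 := by
  have h1 := h.hcq K le_rfl
  have h2 := h.hsum K h.hK
  have h3 := h.hp1 K h.hK
  have h4 := h.hp2 K h.hK
  linarith

lemma Good.ppi_pos (h : Good q p1 p2 P K c) (n : ℕ) : 0 < ppi q p1 p2 K n := by
  refine Finset.prod_pos fun i hi => inv_pos.2 ?_
  have := h.hrho1 i (Finset.mem_Ioc.1 hi).1.le
  linarith

lemma Good.ppi_succ (_h : Good q p1 p2 P K c) {n : ℕ} (hn : K ≤ n) :
    ppi q p1 p2 K (n + 1) = ppi q p1 p2 K n * (rho q p1 p2 (n + 1))⁻¹ := by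
  rw [ppi, ppi, Finset.prod_Ioc_succ_top hn]

lemma Good.ppi_anti (h : Good q p1 p2 P K c) {n m : ℕ} (hn : K ≤ n) (hm : n ≤ m) :
    ppi q p1 p2 K m ≤ ppi q p1 p2 K n := by
  induction m, hm using Nat.le_induction with
  | base => exact le_rfl
  | succ m hm ih =>
    rw [h.ppi_succ (by omega)]
    have h1 := h.hrho1 (m + 1) (by omega)
    have h2 := h.ppi_pos m
    have : (rho q p1 p2 (m + 1))⁻¹ ≤ 1 := inv_le_one_of_one_le₀ h1
    nlinarith

lemma Good.rho_eq (h : Good q p1 p2 P K c) {n : ℕ} (hn : K ≤ n) :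
    q n * rho q p1 p2 n = (p1 n + p2 n) + p2 n * (rho q p1 p2 n)⁻¹ := by
  have hK := h.hK
  have hq := h.hq n (by omega)
  have hr := h.hrho1 n hn
  have hp2 := h.hp2 n (by omega)
  have key : rho q p1 p2 n ^ 2 = (p1 n + p2 n) / q n * rho q p1 p2 n + p2 n / q n := by
    have hs : 0 ≤ ((p1 n + p2 n) / q n) ^ 2 + 4 * (p2 n / q n) := by positivity
    have := Real.sq_sqrt hs
    unfold rho
    set s := Real.sqrt (((p1 n + p2 n) / q n) ^ 2 + 4 * (p2 n / q n))
    nlinarith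
  have hr0 : rho q p1 p2 n ≠ 0 := by positivity
  field_simp at key ⊢
  linarith

lemma Good.sub (h : Good q p1 p2 P K c) {y : ℕ} (hy : K < y) :
    q y * ppi q p1 p2 K (y - 1) ≤
      (p1 y + p2 y) * ppi q p1 p2 K y + p2 y * ppi q p1 p2 K (y + 1) := by
  obtain ⟨z, rfl⟩ : ∃ z, y = z + 1 := ⟨y - 1, by omega⟩
  have e1 := h.ppi_succ (n := z) (by omega)
  have e2 := h.ppi_succ (n := z + 1) (by omega)
  have hr := h.hrho1 (z + 1) hy.le
  have hr' := h.hrho1 (z + 1 + 1) (by omega)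
  have e3 : ppi q p1 p2 K z = ppi q p1 p2 K (z + 1) * rho q p1 p2 (z + 1) := by
    rw [e1]; field_simp
  have e4 := h.rho_eq hy.le
  have hinv : (rho q p1 p2 (z + 1))⁻¹ ≤ (rho q p1 p2 (z + 1 + 1))⁻¹ :=
    inv_anti₀ (by linarith) (h.hmono _ hy.le)
  have hp := h.ppi_pos (z + 1)
  have hK := h.hK
  have hp2 := h.hp2 (z + 1) (by omega)
  rw [Nat.add_sub_cancel, e2, e3]
  have : q (z + 1) * rho q p1 p2 (z + 1) ≤ (p1 (z + 1) + p2 (z + 1)) +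
      p2 (z + 1) * (rho q p1 p2 (z + 1 + 1))⁻¹ := by
    rw [e4]
    have := mul_le_mul_of_nonneg_left hinv hp2.le
    linarith
  have := mul_le_mul_of_nonneg_left this hp.le
  linarith

/-- explicit supersolution -/
def dplus (q p1 p2 : ℕ → ℝ) (K n : ℕ) : ℝ :=
  ppi q p1 p2 K n * (3 - 2 * (rho q p1 p2 (n + 1))⁻¹)

lemma Good.dplus_bounds (h : Good q p1 p2 P K c) {n : ℕ} (hn : K ≤ n) :
    ppi q p1 p2 K n ≤ dplus q p1 p2 K n ∧ dplus q p1 p2 K n ≤ 2 * ppi q p1 p2 K n := by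
  have h1 := h.hrho1 (n + 1) (by omega)
  have h2 := h.hrho2 (n + 1) (by omega)
  have hp := h.ppi_pos n
  have i1 : (rho q p1 p2 (n + 1))⁻¹ ≤ 1 := inv_le_one_of_one_le₀ h1
  have i2 : (2 : ℝ)⁻¹ ≤ (rho q p1 p2 (n + 1))⁻¹ := inv_anti₀ (by linarith) h2
  unfold dplus
  constructor <;> nlinarith

lemma Good.super (h : Good q p1 p2 P K c) {y : ℕ} (hy : K < y) :
    (p1 y + p2 y) * dplus q p1 p2 K y + p2 y * dplus q p1 p2 K (y + 1) ≤
      q y * dplus q p1 p2 K (y - 1) := by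
  obtain ⟨z, rfl⟩ : ∃ z, y = z + 1 := ⟨y - 1, by omega⟩
  have e1 := h.ppi_succ (n := z) (by omega)
  have e2 := h.ppi_succ (n := z + 1) (by omega)
  have hr := h.hrho1 (z + 1) hy.le
  have hr' := h.hrho1 (z + 1 + 1) (by omega)
  have hr'' := h.hrho1 (z + 1 + 1 + 1) (by omega)
  have hr2 := h.hrho2 (z + 1 + 1) (by omega)
  have e3 : ppi q p1 p2 K z = ppi q p1 p2 K (z + 1) * rho q p1 p2 (z + 1) := by
    rw [e1]; field_simp
  have e4 := h.rho_eq hy.le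
  have hinv : (rho q p1 p2 (z + 1))⁻¹ ≤ (rho q p1 p2 (z + 1 + 1))⁻¹ :=
    inv_anti₀ (by linarith) (h.hmono _ hy.le)
  have hinv' : (rho q p1 p2 (z + 1 + 1))⁻¹ ≤ (rho q p1 p2 (z + 1 + 1 + 1))⁻¹ :=
    inv_anti₀ (by linarith) (h.hmono _ (by omega))
  have hhalf : (2 : ℝ)⁻¹ ≤ (rho q p1 p2 (z + 1 + 1))⁻¹ := inv_anti₀ (by linarith) hr2
  have hone : (rho q p1 p2 (z + 1 + 1))⁻¹ ≤ 1 := inv_le_one_of_one_le₀ hr'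
  have hp := h.ppi_pos (z + 1)
  have hK := h.hK
  have hp2 := h.hp2 (z + 1) (by omega)
  have hp1 := h.hp1 (z + 1) (by omega)
  have hq := h.hq (z + 1) (by omega)
  have hb := h.hb (z + 1) hy.le
  simp only [dplus, Nat.add_sub_cancel]
  rw [e2, e3]
  set r := rho q p1 p2 (z + 1)
  set x := r⁻¹ with hx
  set x1 := (rho q p1 p2 (z + 1 + 1))⁻¹
  set x2 := (rho q p1 p2 (z + 1 + 1 + 1))⁻¹
  set A := p1 (z + 1) + p2 (z + 1)
  set Q := q (z + 1)
  set B := p2 (z + 1)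
  have s1 : A * (3 - 2 * x1) + B * (x1 * (3 - 2 * x2)) ≤ Q * (r * (3 - 2 * x)) := by
    have t1 : B * (x1 * (3 - 2 * x2)) ≤ B * (x1 * (3 - 2 * x1)) := by
      have : x1 * (3 - 2 * x2) ≤ x1 * (3 - 2 * x1) :=
        mul_le_mul_of_nonneg_left (by linarith) (by linarith)
      exact mul_le_mul_of_nonneg_left this hp2.le
    have t2 : Q * (r * (3 - 2 * x)) = (A + B * x) * (3 - 2 * x) := by rw [← e4]; ring
    have e4' : A + B * x = Q * r := e4.symm
    have t3 : (A + B * x) * (3 - 2 * x) - (A + B * x1) * (3 - 2 * x1) =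
        (x1 - x) * (2 * (Q * r) - B * (3 - 2 * x1)) := by rw [← e4']; ring
    have t4 : 0 ≤ 2 * (Q * r) - B * (3 - 2 * x1) := by
      have : Q ≤ Q * r := by nlinarith
      have : B * (3 - 2 * x1) ≤ B * 2 := mul_le_mul_of_nonneg_left (by linarith) hp2.le
      linarith
    have t5 := mul_nonneg (sub_nonneg.2 hinv) t4
    nlinarith
  have := mul_le_mul_of_nonneg_left s1 hp.le
  linarith

/-- weight `D(k,N)` (inverse), as a real number -/
def DD (q p1 p2 : ℕ → ℝ) (K k N : ℕ) : ℝ :=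
  (∑ i ∈ Finset.Ico k N, ppi q p1 p2 K i) / ppi q p1 p2 K k

lemma Good.DD_pos (h : Good q p1 p2 P K c) {k N : ℕ} (hkN : k < N) : 0 < DD q p1 p2 K k N :=
  div_pos (Finset.sum_pos (fun i _ => h.ppi_pos i) ⟨k, by simp [hkN]⟩) (h.ppi_pos k)

lemma Good.gup (h : Good q p1 p2 P K c) {k N : ℕ} (hk : K ≤ k) (hkN : k < N)
    {w : ℕ → ℝ} {M : ℝ} (hM : 0 ≤ M)
    (hw : ∀ y, k < y → y < N → w y ≤ avg q p1 p2 w y)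
    (h1 : w k ≤ 0) (h2 : w N ≤ M) (h3 : w (N + 1) ≤ M) :
    w (k + 1) ≤ M * (2 / DD q p1 p2 K k N) := by
  have hK := h.hK
  have hpk := h.ppi_pos k
  have := h.toChain.gambler_up (k := k) (N := N) (d := dplus q p1 p2 K) (w := w) (by omega) hkN hM
    (fun i hi => (h.ppi_pos i).trans_le (h.dplus_bounds (hk.trans hi)).1)
    (fun y hy _ => h.super (by omega)) hw h1 h2 h3
  refine this.trans (mul_le_mul_of_nonneg_left ?_ hM)
  have hs : 0 < ∑ i ∈ Finset.Ico k N, ppi q p1 p2 K i :=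
    Finset.sum_pos (fun i _ => h.ppi_pos i) ⟨k, by simp [hkN]⟩
  have hle : ∑ i ∈ Finset.Ico k N, ppi q p1 p2 K i ≤ ∑ i ∈ Finset.Ico k N, dplus q p1 p2 K i :=
    Finset.sum_le_sum fun i hi => (h.dplus_bounds (hk.trans (Finset.mem_Ico.1 hi).1)).1
  have e : 2 / DD q p1 p2 K k N = 2 * ppi q p1 p2 K k / ∑ i ∈ Finset.Ico k N, ppi q p1 p2 K i := by
    unfold DD; field_simp
  rw [e]
  exact div_le_div₀ (by positivity) (h.dplus_bounds hk).2 hs hle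

lemma Good.glow (h : Good q p1 p2 P K c) {k N : ℕ} (hk : K ≤ k) (hkN : k < N)
    {w : ℕ → ℝ} {M : ℝ} (hM : 0 ≤ M)
    (hw : ∀ y, k < y → y < N → avg q p1 p2 w y ≤ w y)
    (h1 : 0 ≤ w k) (h2 : M ≤ w N) (h3 : M ≤ w (N + 1)) :
    M * (1 / (N + 1 - k : ℝ)) ≤ w (k + 1) := by
  have hK := h.hK
  have hpk := h.ppi_pos k
  have := h.toChain.gambler_low (k := k) (N := N) (d := ppi q p1 p2 K) (w := w) (by omega) hkN hM
    (fun i hi => (h.ppi_pos i))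
    (fun y hy _ => h.sub (by omega)) hw h1 h2 h3
  refine le_trans (mul_le_mul_of_nonneg_left ?_ hM) this
  have hs : 0 < ∑ i ∈ Finset.Ico k (N + 1), ppi q p1 p2 K i :=
    Finset.sum_pos (fun i _ => h.ppi_pos i) ⟨k, by simp; omega⟩
  have hle : ∑ i ∈ Finset.Ico k (N + 1), ppi q p1 p2 K i ≤ (N + 1 - k : ℝ) * ppi q p1 p2 K k := by
    have := Finset.sum_le_card_nsmul (Finset.Ico k (N + 1)) (ppi q p1 p2 K) (ppi q p1 p2 K k)
      (fun i hi => h.ppi_anti hk (Finset.mem_Ico.1 hi).1)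
    rw [Nat.card_Ico, nsmul_eq_mul, Nat.cast_sub (by omega)] at this
    push_cast at this
    exact this
  have hNk : (0 : ℝ) < N + 1 - k := by
    have : (k : ℝ) < N := by exact_mod_cast hkN
    linarith
  rw [div_le_div_iff₀ hNk hs]
  linarith

lemma Good.near (h : Good q p1 p2 P K c) {k : ℕ} (hk : K + 3 ≤ k) {w : ℕ → ℝ}
    (hw0 : ∀ y, 0 ≤ w y) (hw : ∀ y, k ≤ y + 3 → y < k → avg q p1 p2 w y ≤ w y) :
    c ^ 3 * w (k + 1) ≤ w (k - 2) ∧ c ^ 3 * w (k + 1) ≤ w (k - 1) := by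
  obtain ⟨z, rfl⟩ : ∃ z, k = z + 3 := ⟨k - 3, by omega⟩
  have hK := h.hK
  have hc := h.hc
  have hc1 := h.c_le
  have a1 := hw (z + 2) (by omega) (by omega)
  have a2 := hw (z + 1) (by omega) (by omega)
  have a3 := hw z (by omega) (by omega)
  simp only [avg] at a1 a2 a3
  rw [show z + 2 + 2 = z + 3 + 1 by omega] at a1
  rw [show z + 1 - 1 = z by omega] at a2
  rw [show z + 3 - 2 = z + 1 by omega, show z + 3 - 1 = z + 2 by omega]
  have hpos : ∀ y u, 2 ≤ y → 0 ≤ q y * w u ∧ 0 ≤ p1 y * w u ∧ 0 ≤ p2 y * w u := fun y u hy =>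
    ⟨mul_nonneg (h.hq y hy).le (hw0 u), mul_nonneg (h.hp1 y hy) (hw0 u),
      mul_nonneg (h.hp2 y hy).le (hw0 u)⟩
  have b1 : c * w (z + 3 + 1) ≤ w (z + 2) := by
    have := mul_le_mul_of_nonneg_right (h.hcp (z + 2) (by omega)) (hw0 (z + 3 + 1))
    have := (hpos (z + 2) (z + 2 - 1) (by omega)).1
    have := (hpos (z + 2) (z + 2 + 1) (by omega)).2.1
    linarith
  have b2 : c * w (z + 2) ≤ w z := by
    have := mul_le_mul_of_nonneg_right (h.hcp z (by omega)) (hw0 (z + 2))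
    have := (hpos z (z - 1) (by omega)).1
    have := (hpos z (z + 1) (by omega)).2.1
    linarith
  have b3 : c * w z ≤ w (z + 1) := by
    have := mul_le_mul_of_nonneg_right (h.hcq (z + 1) (by omega)) (hw0 z)
    have := (hpos (z + 1) (z + 1 + 1) (by omega)).2.1
    have := (hpos (z + 1) (z + 1 + 2) (by omega)).2.2
    linarith
  have hx := hw0 (z + 3 + 1)
  constructor
  · calc c ^ 3 * w (z + 3 + 1) = c * (c * (c * w (z + 3 + 1))) := by ring
      _ ≤ c * (c * w (z + 2)) := by gcongr
      _ ≤ c * w z := by gcongr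
      _ ≤ _ := b3
  · refine le_trans ?_ b1
    have : c ^ 3 ≤ c := by
      calc c ^ 3 = c * c ^ 2 := by ring
        _ ≤ c * 1 := by
          gcongr
          exact pow_le_one₀ hc.le hc1
        _ = c := mul_one c
    exact mul_le_mul_of_nonneg_right this hx

lemma avg_neg (q p1 p2 : ℕ → ℝ) (w : ℕ → ℝ) (y : ℕ) :
    avg q p1 p2 (fun y => -w y) y = -avg q p1 p2 w y := by
  simp only [avg]; ring

lemma Good.entry (h : Good q p1 p2 P K c) {k : ℕ} (hk : K + 3 ≤ k) {w : ℕ → ℝ}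
    (hw0 : ∀ y, 0 ≤ w y) (hw : ∀ y, 2 ≤ y → y < k → avg q p1 p2 w y ≤ w y)
    (h0 : w 2 ≤ w 0) (h1 : w 0 ≤ w 1) {x : ℕ} (hx : x < k) :
    c ^ 3 * w (k + 1) ≤ w x := by
  have hK := h.hK
  obtain ⟨n1, n2⟩ := h.near hk hw0 (fun y hy hyk => hw y (by omega) hyk)
  have := h.toChain.max2 (k := k - 2) (by omega) (v := fun y => - w y) (B := -(c ^ 3 * w (k + 1)))
    (by simpa using h0) (by simpa using h1)
    (fun y hy hyk => by rw [avg_neg]; have := hw y hy (by omega); linarith)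
    (by simpa using n1) (by rw [show k - 2 + 1 = k - 1 by omega]; simpa using n2) x (by omega)
  linarith

/-- upper bound by value just above `k` -/
lemma Chain.ev_le (h : Chain q p1 p2 P) {k : ℕ} (hk : 2 ≤ k) {S V : Set ℕ} (hkS : k ∈ S)
    (hS : ∀ s ∈ S, k ≤ s) (hV : ∀ s ∈ V, k ≤ s) {x : ℕ} (hx : x < k) :
    (P x).real (ev S V) ≤ (P (k + 1)).real (ev S V) := by
  have nS : ∀ y, y < k → y ∉ S := fun y hy hs => absurd (hS y hs) (by omega)
  have nV : ∀ y, y < k → y ∉ V := fun y hy hs => absurd (hV y hs) (by omega)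
  refine h.max2 hk (v := fun x => (P x).real (ev S V))
    (h.ev_harm0 (nS 0 (by omega)) (nV 0 (by omega))).le
    (h.ev_harm1 (nS 1 (by omega)) (nV 1 (by omega))).le
    (fun y hy hyk => (h.ev_harm hy (nS y hyk) (nV y hyk)).le) ?_ le_rfl x (by omega)
  rw [h.ev_zero hkS]
  exact measureReal_nonneg

lemma Good.ev_ge (h : Good q p1 p2 P K c) {k : ℕ} (hk : K + 3 ≤ k) {S V : Set ℕ}
    (hS : ∀ s ∈ S, k ≤ s) (hV : ∀ s ∈ V, k ≤ s) {x : ℕ} (hx : x < k) :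
    c ^ 3 * (P (k + 1)).real (ev S V) ≤ (P x).real (ev S V) := by
  have nS : ∀ y, y < k → y ∉ S := fun y hy hs => absurd (hS y hs) (by omega)
  have nV : ∀ y, y < k → y ∉ V := fun y hy hs => absurd (hV y hs) (by omega)
  exact h.entry hk (w := fun x => (P x).real (ev S V)) (fun _ => measureReal_nonneg)
    (fun y hy hyk => (h.ev_harm hy (nS y hyk) (nV y hyk)).ge)
    (h.ev_harm0 (nS 0 (by omega)) (nV 0 (by omega))).ge
    (h.ev_harm1 (nS 1 (by omega)) (nV 1 (by omega))).ge hx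

lemma Good.esc_le (h : Good q p1 p2 P K c) {k N : ℕ} (hk : K ≤ k) (hkN : k < N) :
    (P (k + 1)).real (ev {k} ∅) ≤ 2 / DD q p1 p2 K k N := by
  have hK := h.hK
  have := h.prob N
  have := h.prob (N + 1)
  have := h.gup hk hkN (w := fun x => (P x).real (ev {k} ∅)) (M := 1) zero_le_one
    (fun y hy _ => (h.ev_harm (by omega) (by simp; omega) (by simp)).le)
    (by rw [h.ev_zero (by simp)]) measureReal_le_one measureReal_le_one
  simpa using this

lemma Good.pair_le (h : Good q p1 p2 P K c) {k l x : ℕ} (hk : K ≤ k) (hkl : k < l) (hx : x < k) :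
    (P x).real (ev {k, l} ∅) ≤
      (P (l + 1)).real (ev {l} ∅) * (2 / DD q p1 p2 K k l) := by
  have hK := h.hK
  refine (h.ev_le (k := k) (by omega) (by simp) (by simp; omega) (by simp) hx).trans ?_
  have := h.prob (l + 1)
  refine h.gup hk hkl (w := fun x => (P x).real (ev {k, l} ∅)) measureReal_nonneg
    (fun y hy _ => (h.ev_harm (by omega) (by simp; omega) (by simp)).le)
    (by rw [h.ev_zero (by simp)]) ?_ ?_
  · rw [h.ev_zero (by simp)]; exact measureReal_nonneg
  · refine measureReal_mono ?_
    rintro ω ⟨h1, h2⟩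
    exact ⟨fun n hn => h1 n (by simp_all), h2⟩

/-- skip-freeness: starting above `k` and avoiding `k`, one avoids everything below -/
lemma Chain.skipfree (h : Chain q p1 p2 P) {i k : ℕ} (hk : 1 ≤ k) (hik : i < k) (V : Set ℕ) :
    (P (k + 1)).real (ev {k} V) ≤ (P (k + 1)).real (ev {i, k} V) := by
  set B : ℕ → Set (ℕ → ℕ) := fun n => ev {k} ∅ ∩ ⋃ m, ⋃ (_ : m ≤ n), {ω | ω m = i} with hB
  have hBm : ∀ n, MeasurableSet (B n) := fun n =>
    (measurableSet_ev _ _).inter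
      (MeasurableSet.iUnion fun m => MeasurableSet.iUnion fun _ => measurableSet_coord m i)
  have hmem : ∀ n ω, ω ∈ B n ↔ (∀ m, ω m ≠ k) ∧ ∃ m ≤ n, ω m = i := by
    intro n ω; simp [hB, ev]
  have key : ∀ n y, k ≤ y → (P y).real (B n) = 0 := by
    intro n
    induction n with
    | zero =>
      intro y hy
      have : P y (B 0) = 0 := by
        have h3 : ∀ᵐ ω ∂(P y), ω ∉ B 0 := by
          filter_upwards [h.start y] with ω hω hev
          obtain ⟨m, hm, e⟩ := ((hmem 0 ω).1 hev).2
          have : m = 0 := by omega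
          subst this
          omega
        rw [ae_iff] at h3
        simpa using h3
      simp [measureReal_def, this]
    | succ n ih =>
      intro y hy
      rcases eq_or_lt_of_le hy with rfl | hlt
      · have := h.prob k
        have h0 := h.ev_zero (S := {k}) (V := ∅) (x := k) (by simp)
        refine le_antisymm ?_ measureReal_nonneg
        rw [← h0]
        exact measureReal_mono Set.inter_subset_left
      · rw [h.step2 (y := y) (by omega) (hBm n) (B := B (n + 1)), ih _ (by omega), ih _ (by omega),
          ih _ (by omega)]
        · simp
        · intro ω h0
          rw [hmem, hmem]
          constructor
          · rintro ⟨h1, m, hm, e⟩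
            refine ⟨fun m => h1 _, ?_⟩
            rcases m with _ | m
            · omega
            · exact ⟨m, by omega, by rw [add_comm]; exact e⟩
          · rintro ⟨h1, m, hm, e⟩
            refine ⟨fun m => ?_, 1 + m, by omega, e⟩
            rcases m with _ | m
            · omega
            · have := h1 m
              rwa [add_comm] at this
  have := h.prob (k + 1)
  have hnull : P (k + 1) (⋃ n, B n) = 0 := by
    rw [measure_iUnion_null_iff]
    intro n
    have := key n (k + 1) (by omega)
    rw [measureReal_def, ENNReal.toReal_eq_zero_iff] at this
    exact this.resolve_right (measure_ne_top _ _)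
  have : P (k + 1) (ev {k} V) ≤ P (k + 1) (ev {i, k} V) := by
    apply measure_mono_ae
    have h3 : ∀ᵐ ω ∂(P (k + 1)), ω ∉ ⋃ n, B n := by
      exact measure_eq_zero_iff_ae_notMem.1 hnull
    filter_upwards [h3] with ω hω hev
    refine ⟨fun n hn => ?_, hev.2⟩
    rcases hn with e | e
    · apply hω
      refine Set.mem_iUnion.2 ⟨n, (hmem n ω).2 ⟨fun m e' => hev.1 m (by simp [e']), n, le_rfl, e⟩⟩
    · exact hev.1 n e
  exact ENNReal.toReal_mono (measure_ne_top _ _) this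

lemma Good.back (h : Good q p1 p2 P K c) {i k x : ℕ} (hi : K + 3 ≤ i) (hik : i + 4 ≤ k)
    (hx : x < i) {V : Set ℕ} (hV : ∀ s ∈ V, k < s) :
    c ^ 6 * (1 / ((k : ℝ) - i)) * (P x).real (ev {k} V) ≤ (P x).real (ev {i, k} V) := by
  have hK := h.hK
  have hc := h.hc
  have hnn := fun y => (measureReal_nonneg : 0 ≤ (P y).real (ev {i, k} V))
  have nV : ∀ y, y ≤ k → y ∉ V := fun y hy hs => absurd (hV y hs) (by omega)
  have s1 := h.ev_ge hi (S := {i, k}) (V := V) (by simp; omega)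
    (fun s hs => by have := hV s hs; omega) hx
  have s2 := h.ev_le (k := k) (by omega) (S := {k}) (V := V) (by simp) (by simp)
    (fun s hs => by have := hV s hs; omega) (x := x) (by omega)
  have s3 := h.toChain.skipfree (i := i) (k := k) (by omega) (by omega) V
  have hharm : ∀ y, i < y → y < k → avg q p1 p2 (fun x => (P x).real (ev {i, k} V)) y ≤
      (P y).real (ev {i, k} V) := fun y h1 h2 =>
    (h.ev_harm (by omega) (by simp; omega) (nV y (by omega))).ge
  obtain ⟨n1, n2⟩ := h.near (k := k) (by omega) (w := fun x => (P x).real (ev {i, k} V)) hnn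
    (fun y hy hyk => hharm y (by omega) hyk)
  have s4 := h.glow (k := i) (N := k - 2) (by omega) (by omega)
    (w := fun x => (P x).real (ev {i, k} V))
    (mul_nonneg (pow_nonneg hc.le 3) (hnn (k + 1)))
    (fun y hy hyk => hharm y (by omega) (by omega)) (hnn i) n1
    (by rw [show k - 2 + 1 = k - 1 by omega]; exact n2)
  have hki : (4 : ℝ) ≤ k - i := by
    have : (i : ℝ) + 4 ≤ k := by exact_mod_cast hik
    linarith
  have s5 : 1 / ((k : ℝ) - i) ≤ 1 / (((k - 2 : ℕ) : ℝ) + 1 - i) := by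
    rw [Nat.cast_sub (by omega)]
    push_cast
    apply one_div_le_one_div_of_le <;> linarith
  have hc3 : 0 ≤ c ^ 3 := by positivity
  calc c ^ 6 * (1 / ((k : ℝ) - i)) * (P x).real (ev {k} V)
      ≤ c ^ 6 * (1 / (((k - 2 : ℕ) : ℝ) + 1 - i)) * (P (k + 1)).real (ev {i, k} V) := by
        have hd : (0 : ℝ) ≤ 1 / (((k - 2 : ℕ) : ℝ) + 1 - i) :=
          le_trans (one_div_nonneg.2 (by linarith)) s5
        refine mul_le_mul (mul_le_mul_of_nonneg_left s5 (by positivity)) (s2.trans s3)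
          measureReal_nonneg (mul_nonneg (by positivity) hd)
    _ = c ^ 3 * (c ^ 3 * (P (k + 1)).real (ev {i, k} V) *
        (1 / (((k - 2 : ℕ) : ℝ) + 1 - i))) := by ring
    _ ≤ c ^ 3 * (P (i + 1)).real (ev {i, k} V) := mul_le_mul_of_nonneg_left s4 hc3
    _ ≤ _ := s1

lemma Good.esc_ge (h : Good q p1 p2 P K c) (hsm : Summable (ppi q p1 p2 K)) {k : ℕ} (hk : K ≤ k) :
    ppi q p1 p2 K k / (∑' j, ppi q p1 p2 K (k + j)) ≤ (P (k + 1)).real (ev {k} ∅) := by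
  have hK := h.hK
  set F : ℕ → ℝ := fun y => ∑' j, ppi q p1 p2 K (y + j) with hF
  have hsm' : ∀ y, Summable fun j => ppi q p1 p2 K (y + j) := fun y => by
    have := (summable_nat_add_iff y).2 hsm
    simpa [add_comm] using this
  have hFs : ∀ y, F y = ppi q p1 p2 K y + F (y + 1) := by
    intro y
    simp only [hF]
    rw [(hsm' y).tsum_eq_zero_add]
    congr 1
    exact tsum_congr fun j => by rw [show y + (j + 1) = y + 1 + j by omega]
  have hFpos : ∀ y, 0 < F y := fun y =>
    (hsm' y).tsum_pos (fun j => (h.ppi_pos _).le) 0 (h.ppi_pos _)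
  set H : ℕ → Set (ℕ → ℕ) := fun n => ⋃ m, ⋃ (_ : m ≤ n), {ω | ω m = k} with hH
  have hHm : ∀ n, MeasurableSet (H n) := fun n =>
      (MeasurableSet.iUnion fun m => MeasurableSet.iUnion fun _ => measurableSet_coord m k)
  have hmem : ∀ n ω, ω ∈ H n ↔ ∃ m ≤ n, ω m = k := by
    intro n ω; simp [hH]
  have key : ∀ n y, k ≤ y → (P y).real (H n) ≤ F y / F k := by
    intro n
    induction n with
    | zero =>
      intro y hy
      have := h.prob y
      rcases eq_or_lt_of_le hy with rfl | hlt
      · rw [div_self (hFpos k).ne']; exact measureReal_le_one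
      · have : P y (H 0) = 0 := by
          have h3 : ∀ᵐ ω ∂(P y), ω ∉ H 0 := by
            filter_upwards [h.start y] with ω hω hev
            obtain ⟨m, hm, e⟩ := ((hmem 0 ω).1 hev)
            have : m = 0 := by omega
            subst this
            omega
          rw [ae_iff] at h3
          simpa using h3
        rw [measureReal_def, this]
        exact div_nonneg (hFpos y).le (hFpos k).le
    | succ n ih =>
      intro y hy
      have := h.prob y
      rcases eq_or_lt_of_le hy with rfl | hlt
      · rw [div_self (hFpos k).ne']; exact measureReal_le_one
      · rw [h.step2 (y := y) (by omega) (hHm n) (B := H (n + 1))]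
        · have i1 := mul_le_mul_of_nonneg_left (ih (y - 1) (by omega)) (h.hq y (by omega)).le
          have i2 := mul_le_mul_of_nonneg_left (ih (y + 1) (by omega)) (h.hp1 y (by omega))
          have i3 := mul_le_mul_of_nonneg_left (ih (y + 2) (by omega)) (h.hp2 y (by omega)).le
          refine (add_le_add (add_le_add i1 i2) i3).trans ?_
          rw [← mul_div_assoc, ← mul_div_assoc, ← mul_div_assoc, ← add_div, ← add_div]
          refine div_le_div_of_nonneg_right ?_ (hFpos k).le
          have j1 := hFs (y - 1)
          rw [show y - 1 + 1 = y by omega] at j1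
          have j2 := hFs y
          have j3 := hFs (y + 1)
          rw [show y + 1 + 1 = y + 2 by omega] at j3
          have j4 : F (y + 1) = F y - ppi q p1 p2 K y := by linarith
          have j5 : F (y + 2) = F y - ppi q p1 p2 K y - ppi q p1 p2 K (y + 1) := by linarith
          have j6 := h.sub (y := y) (by omega)
          have j7 : q y = 1 - p1 y - p2 y := by have := h.hsum y (by omega); linarith
          rw [j1, j4, j5]
          have : q y * F y + p1 y * F y + p2 y * F y = F y := by
            rw [← add_mul, ← add_mul, h.hsum y (by omega), one_mul]
          linarith
        · intro ω h0
          rw [hmem, hmem]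
          constructor
          · rintro ⟨m, hm, e⟩
            rcases m with _ | m
            · omega
            · exact ⟨m, by omega, by rw [add_comm]; exact e⟩
          · rintro ⟨m, hm, e⟩
            exact ⟨1 + m, by omega, e⟩
  have := h.prob (k + 1)
  have hU : (P (k + 1)).real (⋃ n, H n) ≤ F (k + 1) / F k := by
    have hmon : Monotone H := by
      intro n m hnm ω hω
      obtain ⟨i, hi, e⟩ := (hmem _ _).1 hω
      exact (hmem _ _).2 ⟨i, hi.trans hnm, e⟩
    have : P (k + 1) (⋃ n, H n) ≤ ENNReal.ofReal (F (k + 1) / F k) := by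
      rw [hmon.measure_iUnion]
      refine iSup_le fun n => ?_
      rw [← ENNReal.ofReal_toReal (measure_ne_top (P (k + 1)) (H n))]
      exact ENNReal.ofReal_le_ofReal (key n (k + 1) (by omega))
    exact ENNReal.toReal_le_of_le_ofReal (div_nonneg (hFpos _).le (hFpos k).le) this
  have e : ev {k} ∅ = (⋃ n, H n)ᶜ := by
    ext ω
    simp only [Set.mem_compl_iff, Set.mem_iUnion, hmem, ev, Set.mem_ofPred_eq]
    constructor
    · rintro ⟨h1, _⟩ ⟨n, m, _, e⟩
      exact h1 m (by simp [e])
    · intro h1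
      refine ⟨fun n hn => h1 ⟨n, n, le_rfl, by simpa using hn⟩, by simp⟩
  rw [e, measureReal_compl (MeasurableSet.iUnion hHm)]
  have e1 : (P (k + 1)).real Set.univ = 1 := by simp
  have e2 : ppi q p1 p2 K k / F k = 1 - F (k + 1) / F k := by
    have := hFs k
    have := (hFpos k).ne'
    field_simp
    linarith
  rw [e1]
  show ppi q p1 p2 K k / F k ≤ _
  rw [e2]
  linarith
end


/-! ### Part D: constants, `DY`, and the convergence half -/

lemma exists_good (q p1 p2 : ℕ → ℝ) (P : ℕ → Measure (ℕ → ℕ)) (h : Chain q p1 p2 P)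
    (a b : ℝ) (ha : 0 < a) (hb : 0 < b)
    (hCa : Tendsto (fun k => (p1 k + p2 k) / q k) atTop (𝓝 a))
    (hCb : Tendsto (fun k => p2 k / q k) atTop (𝓝 b))
    (hab : a + b = 1) (N₀ : ℕ)
    (hmono : ∀ k l, N₀ ≤ k → k ≤ l → rho q p1 p2 l ≤ rho q p1 p2 k) :
    ∃ K c, Good q p1 p2 P K c := by
  have hlim : Tendsto (rho q p1 p2) atTop (𝓝 1) := by
    have h1 : Tendsto (fun k => ((p1 k + p2 k) / q k
      + Real.sqrt (((p1 k + p2 k) / q k) ^ 2 + 4 * (p2 k / q k))) / 2) atTop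
      (𝓝 ((a + Real.sqrt (a ^ 2 + 4 * b)) / 2)) :=
      (hCa.add ((hCa.pow 2).add (hCb.const_mul 4)).sqrt).div_const 2
    have h2 : (a + Real.sqrt (a ^ 2 + 4 * b)) / 2 = 1 := by
      have : a ^ 2 + 4 * b = (2 - a) ^ 2 := by
        have : b = 1 - a := by linarith
        rw [this]; ring
      rw [this, Real.sqrt_sq (by linarith)]; ring
    rw [h2] at h1
    exact h1
  have e1 : ∀ᶠ k in atTop, rho q p1 p2 k < 2 := hlim.eventually (gt_mem_nhds (by norm_num))
  have e2 : ∀ᶠ k in atTop, p2 k / q k < 1 := hCb.eventually (gt_mem_nhds (by linarith))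
  have e3 : ∀ᶠ k in atTop, b / 2 < p2 k / q k := hCb.eventually (lt_mem_nhds (by linarith))
  have e4 : ∀ᶠ k in atTop, (p1 k + p2 k) / q k < a + 1 :=
    hCa.eventually (gt_mem_nhds (by linarith))
  obtain ⟨K, hK⟩ := ((e1.and (e2.and (e3.and e4))).and
    (eventually_ge_atTop (N₀ + 2))).exists_forall_of_atTop
  have hKN := (hK K le_rfl).2
  have hqc : ∀ n, K ≤ n → 1 / (a + 2) ≤ q n := by
    intro n hn
    have hq := h.hq n (by omega)
    have hs := h.hsum n (by omega)
    have h4 := (hK n hn).1.2.2.2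
    rw [div_lt_iff₀ hq] at h4
    rw [div_le_iff₀ (by linarith)]
    linarith
  refine ⟨K, b / 2 * (1 / (a + 2)), { toChain := h, hK := by omega, hc := by positivity, hrho1 := ?_, hrho2 := ?_, hmono := ?_, hb := ?_, hcq := ?_, hcp := ?_ }⟩
  · intro n hn
    refine le_of_tendsto hlim ?_
    filter_upwards [eventually_ge_atTop n] with l hl
    exact hmono n l (by omega) hl
  · exact fun n hn => (hK n hn).1.1.le
  · exact fun n hn => hmono n (n + 1) (by omega) (by omega)
  · intro n hn
    have := (hK n hn).1.2.1
    rw [div_lt_one (h.hq n (by omega))] at this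
    exact this.le
  · intro n hn
    refine le_trans ?_ (hqc n hn)
    have : 0 < 1 / (a + 2) := by positivity
    nlinarith
  · intro n hn
    have h3 := (hK n hn).1.2.2.1
    have hq := h.hq n (by omega)
    rw [lt_div_iff₀ hq] at h3
    have := mul_le_mul_of_nonneg_left (hqc n hn) (show 0 ≤ b / 2 by linarith)
    linarith

section
variable {q p1 p2 : ℕ → ℝ} {P : ℕ → Measure (ℕ → ℕ)} {K : ℕ} {c : ℝ}

lemma Good.DY_eq (h : Good q p1 p2 P K c) {n : ℕ} (hn : K ≤ n) :
    DY q p1 p2 n = ∑' j : ℕ, ENNReal.ofReal (ppi q p1 p2 K (n + j) / ppi q p1 p2 K n) := by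
  rw [tsum_eq_zero_add' ENNReal.summable]
  have hp := (h.ppi_pos n).ne'
  rw [add_zero, div_self hp, ENNReal.ofReal_one, DY]
  congr 1
  refine tsum_congr fun j => ?_
  congr 1
  rw [eq_div_iff hp, ppi, ppi]
  have e : Finset.Icc (n + 1) (n + 1 + j) = Finset.Ioc n (n + (j + 1)) := by
    ext i; simp only [Finset.mem_Icc, Finset.mem_Ioc]; omega
  rw [e, mul_comm]
  exact Finset.prod_Ioc_consecutive _ hn (by omega)

lemma Good.avoid_le (h : Good q p1 p2 P K c) {k x : ℕ} (hk : K ≤ k) (hx : x < k) :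
    P x (ev {k} ∅) ≤ 2 * (DY q p1 p2 k)⁻¹ := by
  have hK := h.hK
  have := h.prob x
  have hp := h.ppi_pos k
  have key : P x (ev {k} ∅) * DY q p1 p2 k ≤ 2 := by
    rw [h.DY_eq hk, ← ENNReal.tsum_mul_left]
    refine ENNReal.tsum_le_of_sum_range_le fun n => ?_
    have e1 : P x (ev {k} ∅) = ENNReal.ofReal ((P x).real (ev {k} ∅)) := by
      rw [measureReal_def, ENNReal.ofReal_toReal (measure_ne_top _ _)]
    rw [← Finset.mul_sum, e1, ← ENNReal.ofReal_sum_of_nonneg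
      (fun i _ => (div_pos (h.ppi_pos _) hp).le),
      ← ENNReal.ofReal_mul measureReal_nonneg]
    have e2 : (2 : ℝ≥0∞) = ENNReal.ofReal 2 := by simp
    rw [e2]
    refine ENNReal.ofReal_le_ofReal ?_
    rcases Nat.eq_zero_or_pos n with rfl | hn
    · simp
    have a1 := h.ev_le (k := k) (by omega) (S := {k}) (V := ∅) (by simp) (by simp) (by simp) hx
    have a2 := h.esc_le (N := k + n) hk (by omega)
    have a3 := h.DD_pos (k := k) (N := k + n) (by omega)
    have a4 : ∑ i ∈ Finset.range n, ppi q p1 p2 K (k + i) / ppi q p1 p2 K k =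
        DD q p1 p2 K k (k + n) := by
      rw [DD, Finset.sum_Ico_eq_sum_range, Finset.sum_div]
      simp
    rw [a4, ← le_div_iff₀ a3]
    exact a1.trans a2
  have hD1 : DY q p1 p2 k ≠ 0 := by
    have : (1 : ℝ≥0∞) ≤ DY q p1 p2 k := le_self_add
    intro h0; rw [h0] at this; simp at this
  by_cases hT : DY q p1 p2 k = ⊤
  · rw [hT] at key
    have : P x (ev {k} ∅) = 0 := by
      by_contra h0
      rw [ENNReal.mul_top h0] at key
      simp at key
    rw [this]; simp
  · rw [← div_eq_mul_inv, ENNReal.le_div_iff_mul_le (Or.inl hD1) (Or.inl hT)]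
    exact key

lemma ev_inter (i k : ℕ) (V : Set ℕ) : ev {i, k} V = ev {i} ∅ ∩ ev {k} V := by
  ext ω
  simp only [ev, Set.mem_inter_iff, Set.mem_ofPred_eq]
  constructor
  · rintro ⟨h1, h2⟩
    exact ⟨⟨fun n hn => h1 n (Or.inl hn), by simp⟩, fun n hn => h1 n (Or.inr hn), h2⟩
  · rintro ⟨⟨h1, _⟩, h2, h3⟩
    refine ⟨fun n hn => ?_, h3⟩
    rcases hn with hn | hn
    · exact h1 n hn
    · exact h2 n hn

lemma Good.block (h : Good q p1 p2 P K c) {X Y J : ℕ} (hX : K + 3 + J ≤ X) :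
    c ^ 6 * (∑ j ∈ Finset.Ico (4 : ℕ) J, 1 / (j : ℝ)) *
      (P 2).real (⋃ k ∈ Finset.Ioc X Y, ev {k} ∅) ≤
      ∑ i ∈ Finset.Ioc (X - J) Y, (P 2).real (ev {i} ∅) := by
  have hK := h.hK
  have hc := h.hc
  have := h.prob 2
  have hsub : (⋃ k ∈ Finset.Ioc X Y, ev {k} ∅) ⊆
      ⋃ k ∈ Finset.Ioc X Y, ev {k} (Set.Ioc k Y) := by
    intro ω hω
    simp only [Set.mem_iUnion] at hω ⊢
    obtain ⟨k, hk, hkω⟩ := hω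
    classical
    set S := (Finset.Ioc X Y).filter (fun k => ∀ n, ω n ≠ k) with hS
    have hne : S.Nonempty := by
      refine ⟨k, ?_⟩
      simp only [hS, Finset.mem_filter]
      exact ⟨hk, fun n hn => hkω.1 n hn⟩
    have hm := S.max'_mem hne
    have hmax : ∀ z ∈ S, z ≤ S.max' hne := fun z hz => S.le_max' z hz
    generalize S.max' hne = m at hm hmax
    simp only [hS, Finset.mem_filter] at hm hmax
    refine ⟨m, hm.1, fun n hn => hm.2 n hn, fun i hi => ?_⟩
    by_contra! hcon
    have := hmax i ⟨Finset.mem_Ioc.2 ⟨(Finset.mem_Ioc.1 hm.1).1.trans hi.1, hi.2⟩, hcon⟩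
    exact absurd hi.1 (by omega)
  have hdisj : ∀ k ∈ Finset.Ioc X Y, ∀ l ∈ Finset.Ioc X Y, k < l →
      Disjoint (ev {k} (Set.Ioc k Y)) (ev {l} (Set.Ioc l Y)) := by
    intro k hk l hl hkl
    refine Set.disjoint_left.2 fun ω h1 h2 => ?_
    obtain ⟨n, hn⟩ := h1.2 l ⟨hkl, (Finset.mem_Ioc.1 hl).2⟩
    exact h2.1 n hn
  have hpd : Set.PairwiseDisjoint (↑(Finset.Ioc X Y) : Set ℕ) (fun k => ev {k} (Set.Ioc k Y)) := by
    intro k hk l hl hkl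
    rcases lt_or_gt_of_ne hkl with hlt | hlt
    · exact hdisj k hk l hl hlt
    · exact (hdisj l hl k hk hlt).symm
  set hs := ∑ j ∈ Finset.Ico (4 : ℕ) J, 1 / (j : ℝ) with hhs
  have hs0 : 0 ≤ hs := Finset.sum_nonneg fun j _ => by positivity
  have s1 : (P 2).real (⋃ k ∈ Finset.Ioc X Y, ev {k} ∅) ≤
      ∑ k ∈ Finset.Ioc X Y, (P 2).real (ev {k} (Set.Ioc k Y)) :=
    (measureReal_mono hsub (measure_ne_top _ _)).trans (measureReal_biUnion_finset_le _ _)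
  have s2 : ∀ k ∈ Finset.Ioc X Y, c ^ 6 * hs * (P 2).real (ev {k} (Set.Ioc k Y)) ≤
      ∑ i ∈ Finset.Ioc (X - J) Y, (P 2).real (ev {i} ∅ ∩ ev {k} (Set.Ioc k Y)) := by
    intro k hk
    obtain ⟨hk1, hk2⟩ := Finset.mem_Ioc.1 hk
    have t1 : ∑ j ∈ Finset.Ico 4 J, (P 2).real (ev {k - j} ∅ ∩ ev {k} (Set.Ioc k Y)) ≤
        ∑ i ∈ Finset.Ioc (X - J) Y, (P 2).real (ev {i} ∅ ∩ ev {k} (Set.Ioc k Y)) := by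
      rw [← Finset.sum_image (s := Finset.Ico 4 J) (g := fun j => k - j)
        (f := fun i => (P 2).real (ev {i} ∅ ∩ ev {k} (Set.Ioc k Y)))]
      · refine Finset.sum_le_sum_of_subset_of_nonneg ?_ fun _ _ _ => measureReal_nonneg
        intro i hi
        obtain ⟨j, hj, rfl⟩ := Finset.mem_image.1 hi
        have := Finset.mem_Ico.1 hj
        exact Finset.mem_Ioc.2 ⟨by omega, by omega⟩
      · intro j hj j' hj' e
        have a1 := Finset.mem_Ico.1 hj
        have a2 := Finset.mem_Ico.1 hj'
        simp only at e
        omega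
    refine le_trans ?_ t1
    rw [hhs, Finset.mul_sum, Finset.sum_mul]
    refine Finset.sum_le_sum fun j hj => ?_
    have hj' := Finset.mem_Ico.1 hj
    have := h.back (i := k - j) (k := k) (x := 2) (by omega) (by omega) (by omega)
      (V := Set.Ioc k Y) (fun s hs => hs.1)
    rw [ev_inter, Nat.cast_sub (by omega)] at this
    simpa using this
  calc c ^ 6 * hs * (P 2).real (⋃ k ∈ Finset.Ioc X Y, ev {k} ∅)
      ≤ c ^ 6 * hs * ∑ k ∈ Finset.Ioc X Y, (P 2).real (ev {k} (Set.Ioc k Y)) :=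
        mul_le_mul_of_nonneg_left s1 (by positivity)
    _ = ∑ k ∈ Finset.Ioc X Y, c ^ 6 * hs * (P 2).real (ev {k} (Set.Ioc k Y)) := by
        rw [Finset.mul_sum]
    _ ≤ ∑ k ∈ Finset.Ioc X Y, ∑ i ∈ Finset.Ioc (X - J) Y,
          (P 2).real (ev {i} ∅ ∩ ev {k} (Set.Ioc k Y)) := Finset.sum_le_sum s2
    _ = ∑ i ∈ Finset.Ioc (X - J) Y, ∑ k ∈ Finset.Ioc X Y,
          (P 2).real (ev {i} ∅ ∩ ev {k} (Set.Ioc k Y)) := Finset.sum_comm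
    _ ≤ _ := by
        refine Finset.sum_le_sum fun i _ => ?_
        rw [← measureReal_biUnion_finset]
        · refine measureReal_mono ?_
          intro ω hω
          simp only [Set.mem_iUnion] at hω
          obtain ⟨k, _, hk⟩ := hω
          exact hk.1
        · intro k hk l hl hkl
          exact (hpd hk hl hkl).mono Set.inter_subset_right Set.inter_subset_right
        · intro k _
          exact (measurableSet_ev _ _).inter (measurableSet_ev _ _)

lemma harm_lower (m : ℕ) (hm : 2 ≤ m) :
    ((m : ℝ) - 2) / 2 ≤ ∑ j ∈ Finset.Ico (4 : ℕ) (2 ^ m), 1 / (j : ℝ) := by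
  induction m, hm using Nat.le_induction with
  | base => simp
  | succ m hm ih =>
    have h4 : 4 ≤ 2 ^ m := by
      calc 4 = 2 ^ 2 := by norm_num
        _ ≤ 2 ^ m := Nat.pow_le_pow_right (by norm_num) hm
    rw [← Finset.sum_Ico_consecutive _ h4 (Nat.pow_le_pow_right (by norm_num) (Nat.le_succ m))]
    have : (1 : ℝ) / 2 ≤ ∑ j ∈ Finset.Ico ((2 : ℕ) ^ m) (2 ^ (m + 1)), 1 / (j : ℝ) := by
      have := Finset.card_nsmul_le_sum (Finset.Ico ((2 : ℕ) ^ m) (2 ^ (m + 1))) (fun j => 1 / (j : ℝ))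
        (1 / (2 ^ (m + 1) : ℝ)) (fun j hj => by
          have hj' := Finset.mem_Ico.1 hj
          have h0 : 0 < 2 ^ m := by positivity
          apply one_div_le_one_div_of_le
          · have : 0 < j := by omega
            exact_mod_cast this
          · exact_mod_cast hj'.2.le)
      rw [Nat.card_Ico, nsmul_eq_mul] at this
      refine le_trans (le_of_eq ?_) this
      rw [show 2 ^ (m + 1) - 2 ^ m = 2 ^ m by rw [pow_succ]; omega]
      push_cast
      rw [pow_succ]
      field_simp
    push_cast
    linarith

lemma sum_dyadic_le (t : ℕ → ℝ≥0∞) (r : ℕ) :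
    ∑' m, ∑ i ∈ Finset.Ioc (2 ^ (m + r)) (2 ^ (m + r + 1)), t i ≤ ∑' i, t i := by
  refine ENNReal.tsum_le_of_sum_range_le fun n => ?_
  have : ∑ m ∈ Finset.range n, ∑ i ∈ Finset.Ioc (2 ^ (m + r)) (2 ^ (m + r + 1)), t i =
      ∑ i ∈ Finset.Ioc (2 ^ r) (2 ^ (n + r)), t i := by
    induction n with
    | zero => simp
    | succ n ih =>
      rw [Finset.sum_range_succ, ih, Finset.sum_Ioc_consecutive]
      · congr 2
        ring_nf
      · exact Nat.pow_le_pow_right (by norm_num) (by omega)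
      · exact Nat.pow_le_pow_right (by norm_num) (by omega)
  rw [this]
  exact ENNReal.sum_le_tsum _

lemma Good.half1 (h : Good q p1 p2 P K c)
    (hfin : (∑' n : ℕ,
        (DY q p1 p2 (n + 2) * ENNReal.ofReal (Real.log ((n : ℝ) + 2)))⁻¹) ≠ ⊤) :
    P 2 {ω | {k : ℕ | ∀ n, ω n ≠ k}.Finite} = 1 := by
  have := h.prob 2
  have hK := h.hK
  have hc := h.hc
  -- terms
  set t : ℕ → ℝ≥0∞ := fun n => if 2 ≤ n then
    (DY q p1 p2 n * ENNReal.ofReal (Real.log n))⁻¹ else 0 with ht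
  have htsum : ∑' n, t n ≠ ⊤ := by
    have e : ∑' n, t n = ∑ i ∈ Finset.range 2, t i + ∑' n, t (n + 2) :=
      (Summable.sum_add_tsum_nat_add' ENNReal.summable).symm
    rw [e]
    have : ∀ n : ℕ, t (n + 2) =
        (DY q p1 p2 (n + 2) * ENNReal.ofReal (Real.log ((n : ℝ) + 2)))⁻¹ := by
      intro n; simp [ht]
    simp only [this]
    simp [Finset.sum_range_succ, ht, hfin]
  -- blocks
  set A : ℕ → Set (ℕ → ℕ) := fun m => ⋃ k ∈ Finset.Ioc (2 ^ (m + 1)) (2 ^ (m + 2)), ev {k} ∅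
    with hA
  set C : ℝ≥0∞ := ENNReal.ofReal (4 / c ^ 6) * 4 with hC
  have hCtop : C ≠ ⊤ := by rw [hC]; finiteness
  have hbound : ∀ m, K + 4 ≤ m → P 2 (A m) ≤
      C * (∑ i ∈ Finset.Ioc (2 ^ m) (2 ^ (m + 2)), t i) := by
    intro m hm
    have h2m : m < 2 ^ m := Nat.lt_two_pow_self
    have b1 := h.block (X := 2 ^ (m + 1)) (Y := 2 ^ (m + 2)) (J := 2 ^ m)
      (by rw [pow_succ]; omega)
    rw [show 2 ^ (m + 1) - 2 ^ m = 2 ^ m by rw [pow_succ]; omega] at b1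
    have b2 := harm_lower m (by omega)
    have hmR : (4 : ℝ) ≤ m := by exact_mod_cast (by omega : 4 ≤ m)
    have b3 : (m : ℝ) / 4 ≤ ∑ j ∈ Finset.Ico (4 : ℕ) (2 ^ m), 1 / (j : ℝ) := by linarith
    have hc6 : 0 < c ^ 6 := by positivity
    have b4 : (P 2).real (A m) ≤ 4 / c ^ 6 * (∑ i ∈ Finset.Ioc (2 ^ m) (2 ^ (m + 2)),
        (P 2).real (ev {i} ∅) * (1 / m)) := by
      rw [← Finset.sum_mul]
      have : c ^ 6 * (m / 4) * (P 2).real (A m) ≤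
          ∑ i ∈ Finset.Ioc (2 ^ m) (2 ^ (m + 2)), (P 2).real (ev {i} ∅) := by
        refine le_trans ?_ b1
        gcongr
      have hm0 : (0 : ℝ) < m := by linarith
      rw [show 4 / c ^ 6 * ((∑ i ∈ Finset.Ioc (2 ^ m) (2 ^ (m + 2)), (P 2).real (ev {i} ∅)) *
        (1 / m)) = (∑ i ∈ Finset.Ioc (2 ^ m) (2 ^ (m + 2)), (P 2).real (ev {i} ∅)) /
          (c ^ 6 * (m / 4)) by field_simp]
      rw [le_div_iff₀ (by positivity)]
      linarith
    have b5 : P 2 (A m) ≤ ENNReal.ofReal (4 / c ^ 6) *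
        ∑ i ∈ Finset.Ioc (2 ^ m) (2 ^ (m + 2)), P 2 (ev {i} ∅) * ENNReal.ofReal (1 / m) := by
      have e1 : P 2 (A m) = ENNReal.ofReal ((P 2).real (A m)) := by
        rw [measureReal_def, ENNReal.ofReal_toReal (measure_ne_top _ _)]
      rw [e1]
      refine (ENNReal.ofReal_le_ofReal b4).trans (le_of_eq ?_)
      rw [ENNReal.ofReal_mul (by positivity), ENNReal.ofReal_sum_of_nonneg
        (fun i _ => by positivity)]
      congr 1
      refine Finset.sum_congr rfl fun i _ => ?_
      rw [ENNReal.ofReal_mul measureReal_nonneg, measureReal_def,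
        ENNReal.ofReal_toReal (measure_ne_top _ _)]
    refine b5.trans ?_
    rw [hC, mul_assoc]
    refine mul_le_mul_right ?_ _
    rw [Finset.mul_sum]
    refine Finset.sum_le_sum fun i hi => ?_
    obtain ⟨hi1, hi2⟩ := Finset.mem_Ioc.1 hi
    have hiK : K ≤ i := by omega
    have hi2' : 2 ≤ i := by omega
    have c1 := h.avoid_le (k := i) (x := 2) hiK (by omega)
    have hlogpos : 0 < Real.log i := Real.log_pos (by exact_mod_cast (by omega : 1 < i))
    have hlog : Real.log i ≤ 2 * m := by
      have : (i : ℝ) ≤ 2 ^ (m + 2) := by exact_mod_cast hi2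
      calc Real.log i ≤ Real.log (2 ^ (m + 2)) := Real.log_le_log (by positivity) this
        _ = (m + 2 : ℕ) * Real.log 2 := Real.log_pow _ _
        _ ≤ (m + 2 : ℕ) * 1 := by
          gcongr
          have := Real.log_two_lt_d9
          linarith
        _ ≤ 2 * m := by push_cast; linarith
    have c2 : ENNReal.ofReal (1 / m) ≤ 2 * (ENNReal.ofReal (Real.log i))⁻¹ := by
      rw [← ENNReal.ofReal_inv_of_pos hlogpos]
      have e2 : (2 : ℝ≥0∞) = ENNReal.ofReal 2 := by simp
      rw [e2, ← ENNReal.ofReal_mul (by norm_num)]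
      refine ENNReal.ofReal_le_ofReal ?_
      rw [← div_eq_mul_inv, div_le_div_iff₀ (by linarith) hlogpos]
      linarith
    have c3 : t i = (DY q p1 p2 i)⁻¹ * (ENNReal.ofReal (Real.log i))⁻¹ := by
      simp only [ht, hi2', if_true]
      refine ENNReal.mul_inv (Or.inr ENNReal.ofReal_ne_top) (Or.inr ?_)
      simpa using hlogpos
    rw [c3]
    calc P 2 (ev {i} ∅) * ENNReal.ofReal (1 / m)
        ≤ (2 * (DY q p1 p2 i)⁻¹) * (2 * (ENNReal.ofReal (Real.log i))⁻¹) := by gcongr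
      _ = _ := by ring
  have hsumA : ∑' m, P 2 (A (m + (K + 4))) ≠ ⊤ := by
    have le1 : ∑' m, P 2 (A (m + (K + 4))) ≤ C * (∑' i, t i + ∑' i, t i) := by
      calc ∑' m, P 2 (A (m + (K + 4)))
          ≤ ∑' m, C * (∑ i ∈ Finset.Ioc (2 ^ (m + (K + 4))) (2 ^ (m + (K + 4) + 2)), t i) :=
            ENNReal.tsum_le_tsum fun m => hbound _ (by omega)
        _ = C * ∑' m, (∑ i ∈ Finset.Ioc (2 ^ (m + (K + 4))) (2 ^ (m + (K + 4) + 1)), t i +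
              ∑ i ∈ Finset.Ioc (2 ^ (m + (K + 5))) (2 ^ (m + (K + 5) + 1)), t i) := by
            rw [ENNReal.tsum_mul_left]
            congr 1
            refine tsum_congr fun m => ?_
            rw [show m + (K + 5) = m + (K + 4) + 1 by omega, Finset.sum_Ioc_consecutive]
            · exact Nat.pow_le_pow_right (by norm_num) (by omega)
            · exact Nat.pow_le_pow_right (by norm_num) (by omega)
        _ ≤ _ := by
            rw [ENNReal.tsum_add]
            exact mul_le_mul_right (add_le_add (sum_dyadic_le t _) (sum_dyadic_le t _)) _
    refine ne_top_of_le_ne_top ?_ le1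
    finiteness
  have hbc := measure_setOfPred_frequently_eq_zero (μ := P 2)
    (p := fun m ω => ω ∈ A (m + (K + 4))) hsumA
  have hae : ∀ᵐ ω ∂(P 2), {k : ℕ | ∀ n, ω n ≠ k}.Finite := by
    have h3 := measure_eq_zero_iff_ae_notMem.1 hbc
    filter_upwards [h3] with ω hω
    by_contra hinf
    apply hω
    show ∃ᶠ m in atTop, ω ∈ A (m + (K + 4))
    rw [Filter.frequently_atTop]
    intro m
    obtain ⟨k, hk, hkm⟩ := Set.Infinite.exists_gt (show Set.Infinite _ from hinf)
      (2 ^ (m + K + 5))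
    set l := Nat.log 2 (k - 1) with hl
    have h1 : 2 ^ l ≤ k - 1 := Nat.pow_log_le_self 2 (by
      have : 0 < 2 ^ (m + K + 5) := by positivity
      omega)
    have h2 : k - 1 < 2 ^ (l + 1) := Nat.lt_pow_succ_log_self (by norm_num) _
    have h3 : m + K + 5 ≤ l := by
      by_contra hlt
      have : 2 ^ (l + 1) ≤ 2 ^ (m + K + 5) := Nat.pow_le_pow_right (by norm_num) (by omega)
      omega
    refine ⟨l - 1 - (K + 4), by omega, ?_⟩
    simp only [hA, Set.mem_iUnion]
    refine ⟨k, ?_, fun n hn => hk n hn, by simp⟩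
    rw [show l - 1 - (K + 4) + (K + 4) + 1 = l by omega,
      show l - 1 - (K + 4) + (K + 4) + 2 = l + 1 by omega]
    exact Finset.mem_Ioc.2 ⟨by omega, by omega⟩
  rw [measure_congr (eventuallyEq_univ.2 hae), measure_univ]
end


/-! ### Part E: zero-one law -/

lemma zero_one_aux (μ : Measure (ℕ → ℕ)) [IsProbabilityMeasure μ] (B : Set (ℕ → ℕ))
    (hB : MeasurableSet B) (r : ℝ≥0∞)
    (hcyl : ∀ w t, μ (B ∩ cyl w t) ≤ r * μ (cyl w t)) (t : ℕ) (E : Set (ℕ → ℕ))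
    (hE : ∀ ω ∈ E, cyl ω t ⊆ E) (hEm : MeasurableSet E) : μ (B ∩ E) ≤ r * μ E := by
  set π : (ℕ → ℕ) → (Fin (t + 1) → ℕ) := fun ω i => ω i with hπ
  have hπm : Measurable π := measurable_pi_lambda _ fun i => measurable_pi_apply _
  have hsplit : ∀ A : Set (ℕ → ℕ), MeasurableSet A → μ A = ∑' v, μ (A ∩ π ⁻¹' {v}) := by
    intro A hA
    rw [← measure_iUnion]
    · congr 1
      ext ω
      simp
    · intro v v' hv
      refine Set.disjoint_left.2 fun ω h1 h2 => hv ?_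
      rw [← h1.2, ← h2.2]
    · intro v
      exact hA.inter (hπm (measurableSet_singleton _))
  rw [hsplit _ (hB.inter hEm), hsplit E hEm, ← ENNReal.tsum_mul_left]
  refine ENNReal.tsum_le_tsum fun v => ?_
  by_cases hne : (E ∩ π ⁻¹' {v}).Nonempty
  · obtain ⟨ω, hω, hv⟩ := hne
    have e : E ∩ π ⁻¹' {v} = cyl ω t := by
      ext ω'
      constructor
      · rintro ⟨_, h2⟩ i hi
        have : π ω' = π ω := by rw [h2, hv]
        exact congrFun this ⟨i, by omega⟩
      · intro h'
        refine ⟨hE ω hω h', ?_⟩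
        rw [Set.mem_preimage, Set.mem_singleton_iff, ← hv]
        funext i
        exact h' i (by omega)
    rw [Set.inter_assoc, e]
    exact hcyl ω t
  · rw [Set.not_nonempty_iff_eq_empty] at hne
    rw [Set.inter_assoc, hne]
    simp

lemma zero_one {p : ℕ → ℕ → ℝ} {P : ℕ → Measure (ℕ → ℕ)} (hP : IsFamily P p)
    (I : Set (ℕ → ℕ)) (hI : MeasurableSet I)
    (hinv : ∀ t (ω : ℕ → ℕ), (fun i => ω (t + i)) ∈ I ↔ ω ∈ I)
    (η : ℝ) (hη : 0 < η) (hlow : ∀ x, ENNReal.ofReal η ≤ P x I) (x : ℕ) : P x I = 1 := by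
  have := (hP x).1
  set r : ℝ≥0∞ := 1 - ENNReal.ofReal η with hr
  have hr1 : r < 1 := ENNReal.sub_lt_self (by simp) (by simp) (by simpa using hη)
  have hcyl : ∀ w t, P x (Iᶜ ∩ cyl w t) ≤ r * P x (cyl w t) := by
    intro w t
    have h1 := family_markov hP x w t hI.compl
    have h2 : {ω : ℕ → ℕ | (fun i => ω (t + i)) ∈ Iᶜ} = Iᶜ := by
      ext ω
      exact not_congr (hinv t ω)
    rw [h2] at h1
    rw [h1, mul_comm]
    have := (hP (w t)).1
    gcongr
    rw [prob_compl_eq_one_sub hI]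
    exact tsub_le_tsub_left (hlow _) _
  have hU : ∀ U, IsOpen U → Iᶜ ⊆ U → P x Iᶜ ≤ r * P x U := by
    intro U hUo hsub
    set E : ℕ → Set (ℕ → ℕ) := fun t => {ω | cyl ω t ⊆ U} with hE
    have hEc : ∀ t, ∀ ω ∈ E t, cyl ω t ⊆ E t := by
      intro t ω hω ω' hω' ω'' hω''
      exact hω fun i hi => (hω'' i hi).trans (hω' i hi)
    have hEo : ∀ t, IsOpen (E t) := by
      intro t
      rw [isOpen_iff_mem_nhds]
      intro ω hω
      refine mem_of_superset ?_ (hEc t ω hω)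
      have : cyl ω t = ⋂ i ∈ Finset.range (t + 1), (fun ω' : ℕ → ℕ => ω' i) ⁻¹' {ω i} := by
        ext ω'
        simp [cyl]
      rw [this]
      refine (isOpen_biInter_finset fun i _ => ?_).mem_nhds ?_
      · exact (isOpen_discrete _).preimage (continuous_apply i)
      · simp
    have hmono : Monotone E := by
      intro s t hst ω hω ω' hω'
      exact hω fun i hi => hω' i (hi.trans hst)
    have hUE : U = ⋃ t, E t := by
      ext ω
      constructor
      · intro hω
        have hn := hUo.mem_nhds hω
        rw [nhds_pi, Filter.mem_pi] at hn
        obtain ⟨J, hJ, s, hs, hsU⟩ := hn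
        obtain ⟨t, ht⟩ := hJ.bddAbove
        refine Set.mem_iUnion.2 ⟨t, fun ω' hω' => hsU fun i hi => ?_⟩
        rw [hω' i (ht hi)]
        exact mem_of_mem_nhds (hs i)
      · intro hω
        obtain ⟨t, ht⟩ := Set.mem_iUnion.1 hω
        exact ht fun i _ => rfl
    have e1 : Iᶜ = ⋃ t, Iᶜ ∩ E t := by
      rw [← Set.inter_iUnion, ← hUE, Set.inter_eq_left.2 hsub]
    rw [e1, (show Monotone fun t => Iᶜ ∩ E t from
      fun s t hst => Set.inter_subset_inter_right _ (hmono hst)).measure_iUnion]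
    refine iSup_le fun t => ?_
    refine (zero_one_aux (P x) Iᶜ hI.compl r hcyl t (E t) (hEc t) (hEo t).measurableSet).trans ?_
    gcongr
    rw [hUE]
    exact Set.subset_iUnion _ _
  have hle : P x Iᶜ ≤ r * P x Iᶜ := by
    refine ENNReal.le_of_forall_pos_le_add fun ε hε _ => ?_
    obtain ⟨U, hsub, hUo, hlt⟩ := Iᶜ.exists_isOpen_lt_add (μ := P x) (measure_ne_top _ _)
      (show (ε : ℝ≥0∞) ≠ 0 by simpa using hε.ne')
    refine (hU U hUo hsub).trans ?_
    calc r * P x U ≤ r * (P x Iᶜ + ε) := by gcongr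
      _ = r * P x Iᶜ + r * ε := mul_add _ _ _
      _ ≤ r * P x Iᶜ + 1 * ε := by gcongr
      _ = _ := by rw [one_mul]
  have h0 : P x Iᶜ = 0 := by
    by_contra hne
    have : r * P x Iᶜ < 1 * P x Iᶜ :=
      ENNReal.mul_lt_mul_left hne (measure_ne_top _ _) hr1
    rw [one_mul] at this
    exact absurd hle (not_le.2 this)
  rwa [prob_compl_eq_zero_iff hI] at h0

lemma second_moment {Ω : Type*} [MeasurableSpace Ω] (μ : Measure Ω) [IsProbabilityMeasure μ]
    (s : Finset ℕ) (A : ℕ → Set Ω) (hA : ∀ k, MeasurableSet (A k)) (w : ℕ → ℝ) :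
    (∑ k ∈ s, w k * μ.real (A k)) ^ 2 ≤
      (∑ k ∈ s, ∑ l ∈ s, w k * w l * μ.real (A k ∩ A l)) * μ.real (⋃ k ∈ s, A k) := by
  set U := ⋃ k ∈ s, A k with hU
  have hUm : MeasurableSet U := Finset.measurableSet_biUnion _ fun k _ => hA k
  have ii : ∀ B : Set Ω, MeasurableSet B → Integrable (B.indicator (fun _ => (1 : ℝ))) μ :=
    fun B hB => (integrable_const _).indicator hB
  have iv : ∀ B : Set Ω, MeasurableSet B → ∫ ω, B.indicator (fun _ => (1 : ℝ)) ω ∂μ = μ.real B :=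
    fun B hB => by rw [integral_indicator hB]; simp
  have hmul : ∀ B C : Set Ω, ∀ ω, B.indicator (fun _ => (1 : ℝ)) ω *
      C.indicator (fun _ => (1 : ℝ)) ω = (B ∩ C).indicator (fun _ => (1 : ℝ)) ω := by
    intro B C ω
    by_cases h1 : ω ∈ B <;> by_cases h2 : ω ∈ C <;> simp [h1, h2]
  set M := ∑ k ∈ s, w k * μ.real (A k) with hM
  set V := ∑ k ∈ s, ∑ l ∈ s, w k * w l * μ.real (A k ∩ A l) with hV
  have key : ∀ x : ℝ, 0 ≤ μ.real U * (x * x) + (-2 * M) * x + V := by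
    intro x
    have hInteg : ∫ ω, ((∑ k ∈ s, ∑ l ∈ s, w k * w l *
        (A k ∩ A l).indicator (fun _ => (1 : ℝ)) ω) + (-2 * x) *
        (∑ k ∈ s, w k * (A k).indicator (fun _ => (1 : ℝ)) ω) +
        x * x * U.indicator (fun _ => (1 : ℝ)) ω) ∂μ =
        μ.real U * (x * x) + (-2 * M) * x + V := by
      have i1 : Integrable (fun ω => ∑ k ∈ s, ∑ l ∈ s, w k * w l *
        (A k ∩ A l).indicator (fun _ => (1 : ℝ)) ω) μ :=
        integrable_finsetSum _ fun k _ => integrable_finsetSum _ fun l _ =>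
          (ii _ ((hA k).inter (hA l))).const_mul _
      have i2 : Integrable (fun ω => ∑ k ∈ s, w k * (A k).indicator (fun _ => (1 : ℝ)) ω) μ :=
        integrable_finsetSum _ fun k _ => (ii _ (hA k)).const_mul _
      have i3 : Integrable (fun ω => (∑ k ∈ s, ∑ l ∈ s, w k * w l *
        (A k ∩ A l).indicator (fun _ => (1 : ℝ)) ω) + (-2 * x) *
        (∑ k ∈ s, w k * (A k).indicator (fun _ => (1 : ℝ)) ω)) μ := i1.add (i2.const_mul _)
      rw [integral_add i3 ((ii _ hUm).const_mul _),
        integral_add i1 (i2.const_mul _), integral_const_mul, integral_const_mul, iv _ hUm,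
        integral_finsetSum _ fun k _ => (ii _ (hA k)).const_mul _,
        integral_finsetSum _ fun k _ => integrable_finsetSum _ fun l _ =>
          (ii _ ((hA k).inter (hA l))).const_mul _]
      have : ∀ k, ∫ ω, ∑ l ∈ s, w k * w l * (A k ∩ A l).indicator (fun _ => (1 : ℝ)) ω ∂μ =
          ∑ l ∈ s, w k * w l * μ.real (A k ∩ A l) := by
        intro k
        rw [integral_finsetSum _ fun l _ => (ii _ ((hA k).inter (hA l))).const_mul _]
        refine Finset.sum_congr rfl fun l _ => ?_
        rw [integral_const_mul, iv _ ((hA k).inter (hA l))]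
      simp only [this, integral_const_mul, iv _ (hA _)]
      rw [← hM, ← hV]
      ring
    rw [← hInteg]
    refine integral_nonneg fun ω => ?_
    have e1 : (∑ k ∈ s, ∑ l ∈ s, w k * w l * (A k ∩ A l).indicator (fun _ => (1 : ℝ)) ω) =
        (∑ k ∈ s, w k * (A k).indicator (fun _ => (1 : ℝ)) ω) ^ 2 := by
      rw [sq, Finset.sum_mul_sum]
      refine Finset.sum_congr rfl fun k _ => Finset.sum_congr rfl fun l _ => ?_
      rw [← hmul]; ring
    have e2 : (∑ k ∈ s, w k * (A k).indicator (fun _ => (1 : ℝ)) ω) =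
        (∑ k ∈ s, w k * (A k).indicator (fun _ => (1 : ℝ)) ω) *
          U.indicator (fun _ => (1 : ℝ)) ω := by
      rw [Finset.sum_mul]
      refine Finset.sum_congr rfl fun k hk => ?_
      have hsub : A k ⊆ U := by
        intro z hz
        rw [hU]
        exact Set.mem_biUnion hk hz
      rw [mul_assoc, hmul, Set.inter_eq_left.2 hsub]
    have e3 : U.indicator (fun _ => (1 : ℝ)) ω * U.indicator (fun _ => (1 : ℝ)) ω =
        U.indicator (fun _ => (1 : ℝ)) ω := by rw [hmul, Set.inter_self]
    rw [Pi.zero_apply, e1]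
    set Z := ∑ k ∈ s, w k * (A k).indicator (fun _ => (1 : ℝ)) ω
    set u := U.indicator (fun _ => (1 : ℝ)) ω
    have : Z ^ 2 + -2 * x * Z + x * x * u = (Z - x * u) ^ 2 := by
      calc Z ^ 2 + -2 * x * Z + x * x * u = Z ^ 2 + -2 * x * (Z * u) + x * x * (u * u) := by
            rw [← e2, e3]
        _ = _ := by ring
    rw [this]
    positivity
  have := discrim_le_zero key
  rw [discrim] at this
  nlinarith


section
variable {q p1 p2 : ℕ → ℝ} {P : ℕ → Measure (ℕ → ℕ)} {K : ℕ} {c : ℝ}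

/-- real-valued version of `DY` -/
def Dr (q p1 p2 : ℕ → ℝ) (K k : ℕ) : ℝ := (∑' j, ppi q p1 p2 K (k + j)) / ppi q p1 p2 K k

lemma summable_ppi_add (hsm : Summable (ppi q p1 p2 K)) (k : ℕ) :
    Summable fun j => ppi q p1 p2 K (k + j) := by
  have := (summable_nat_add_iff k).2 hsm
  simpa [add_comm] using this

lemma Good.Dr_eq (h : Good q p1 p2 P K c) (hsm : Summable (ppi q p1 p2 K)) {k l : ℕ}
    (hkl : k ≤ l) : Dr q p1 p2 K k = DD q p1 p2 K k l +
      ppi q p1 p2 K l / ppi q p1 p2 K k * Dr q p1 p2 K l := by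
  have hk := (h.ppi_pos k).ne'
  have hl := (h.ppi_pos l).ne'
  obtain ⟨n, rfl⟩ := Nat.exists_eq_add_of_le hkl
  have e := (summable_ppi_add hsm k).sum_add_tsum_nat_add n
  have e2 : ∑' j, ppi q p1 p2 K (k + (j + n)) = ∑' j, ppi q p1 p2 K (k + n + j) :=
    tsum_congr fun j => by congr 1; omega
  rw [e2] at e
  rw [Dr, Dr, DD, Finset.sum_Ico_eq_sum_range, Nat.add_sub_cancel_left, ← e]
  field_simp

lemma Good.Dr_nonneg (h : Good q p1 p2 P K c) (k : ℕ) : 0 ≤ Dr q p1 p2 K k :=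
  div_nonneg (tsum_nonneg fun j => (h.ppi_pos _).le) (h.ppi_pos k).le

lemma Good.DD_le_Dr (h : Good q p1 p2 P K c) (hsm : Summable (ppi q p1 p2 K)) {k l : ℕ}
    (hkl : k ≤ l) : DD q p1 p2 K k l ≤ Dr q p1 p2 K k := by
  rw [h.Dr_eq hsm hkl]
  have := mul_nonneg (div_pos (h.ppi_pos l) (h.ppi_pos k)).le (h.Dr_nonneg l)
  linarith

lemma Good.DD_self (h : Good q p1 p2 P K c) (k : ℕ) : DD q p1 p2 K k (k + 1) = 1 := by
  rw [DD, Nat.Ico_succ_singleton, Finset.sum_singleton, div_self (h.ppi_pos k).ne']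

lemma Good.DD_succ (h : Good q p1 p2 P K c) {k l : ℕ} (hkl : k ≤ l) :
    DD q p1 p2 K k (l + 1) = DD q p1 p2 K k l + ppi q p1 p2 K l / ppi q p1 p2 K k := by
  rw [DD, DD, Finset.sum_Ico_succ_top hkl, add_div]

lemma Good.one_le_DD (h : Good q p1 p2 P K c) {k l : ℕ} (hkl : k < l) :
    1 ≤ DD q p1 p2 K k l := by
  induction l, hkl using Nat.le_induction with
  | base => exact (h.DD_self k).ge
  | succ l hl ih =>
    rw [h.DD_succ (by omega)]
    have := div_pos (h.ppi_pos l) (h.ppi_pos k)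
    linarith

lemma Good.one_le_Dr (h : Good q p1 p2 P K c) (hsm : Summable (ppi q p1 p2 K)) (k : ℕ) :
    1 ≤ Dr q p1 p2 K k := (h.one_le_DD (Nat.lt_succ_self k)).trans (h.DD_le_Dr hsm (by omega))

lemma Good.DY_eq_Dr (h : Good q p1 p2 P K c) (hsm : Summable (ppi q p1 p2 K)) {k : ℕ}
    (hk : K ≤ k) : DY q p1 p2 k = ENNReal.ofReal (Dr q p1 p2 K k) := by
  rw [h.DY_eq hk, Dr, ← tsum_div_const, ENNReal.ofReal_tsum_of_nonneg]
  · exact fun j => (div_pos (h.ppi_pos _) (h.ppi_pos _)).le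
  · exact (summable_ppi_add hsm k).div_const _

lemma Good.summable_of_DY (h : Good q p1 p2 P K c) {k : ℕ} (hk : K ≤ k)
    (hD : DY q p1 p2 k ≠ ⊤) : Summable (ppi q p1 p2 K) := by
  rw [h.DY_eq hk] at hD
  have h1 := ENNReal.summable_toReal hD
  have hp := h.ppi_pos k
  have h2 : Summable fun j => ppi q p1 p2 K (k + j) := by
    have := h1.mul_right (ppi q p1 p2 K k)
    refine this.congr fun j => ?_
    rw [ENNReal.toReal_ofReal (div_pos (h.ppi_pos _) hp).le, div_mul_cancel₀ _ hp.ne']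
  rw [← summable_nat_add_iff k]
  simpa [add_comm] using h2

lemma Good.esc_le_Dr (h : Good q p1 p2 P K c) (hsm : Summable (ppi q p1 p2 K)) {k : ℕ}
    (hk : K ≤ k) : (P (k + 1)).real (ev {k} ∅) ≤ 2 / Dr q p1 p2 K k := by
  have h1 := h.one_le_Dr hsm k
  have lim : Tendsto (fun n => DD q p1 p2 K k (k + n)) atTop (𝓝 (Dr q p1 p2 K k)) := by
    have := ((summable_ppi_add hsm k).hasSum.tendsto_sum_nat).div_const (ppi q p1 p2 K k)
    refine this.congr fun n => ?_
    rw [DD, Finset.sum_Ico_eq_sum_range, Nat.add_sub_cancel_left]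
  have lim2 : Tendsto (fun n => 2 / DD q p1 p2 K k (k + n)) atTop (𝓝 (2 / Dr q p1 p2 K k)) :=
    tendsto_const_nhds.div lim (by positivity)
  refine ge_of_tendsto lim2 ?_
  filter_upwards [eventually_ge_atTop 1] with n hn
  exact h.esc_le hk (by omega)

lemma Good.sum_log (h : Good q p1 p2 P K c) (hsm : Summable (ppi q p1 p2 K)) {k : ℕ}
    (hk : K ≤ k) (M : ℕ) :
    ∑ l ∈ Finset.Ico (k + 1) M, (ppi q p1 p2 K l / ppi q p1 p2 K k) / DD q p1 p2 K k l ≤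
      2 * Real.log (Dr q p1 p2 K k) := by
  have main : ∀ M, k + 1 ≤ M → ∑ l ∈ Finset.Ico (k + 1) M,
      (ppi q p1 p2 K l / ppi q p1 p2 K k) / DD q p1 p2 K k l ≤
      2 * Real.log (DD q p1 p2 K k M) := by
    intro M hM
    induction M, hM using Nat.le_induction with
    | base => simp [h.DD_self k]
    | succ l hl ih =>
      rw [Finset.sum_Ico_succ_top hl, h.DD_succ (by omega)]
      have hD := h.one_le_DD (k := k) (l := l) (by omega)
      set D := DD q p1 p2 K k l
      have hr0 : 0 < ppi q p1 p2 K l / ppi q p1 p2 K k := div_pos (h.ppi_pos l) (h.ppi_pos k)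
      have hr1 : ppi q p1 p2 K l / ppi q p1 p2 K k ≤ 1 :=
        (div_le_one (h.ppi_pos k)).2 (h.ppi_anti hk (by omega))
      set r := ppi q p1 p2 K l / ppi q p1 p2 K k
      have e : Real.log (D + r) = Real.log D + Real.log (1 + r / D) := by
        rw [← Real.log_mul (by positivity) (by positivity)]
        congr 1
        field_simp
      have h3 := Real.one_sub_inv_le_log_of_pos (show 0 < 1 + r / D by positivity)
      have h4 : r / D / 2 ≤ 1 - (1 + r / D)⁻¹ := by
        have hu1 : r / D ≤ 1 := (div_le_one (by linarith)).2 (by linarith)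
        have hu0 : 0 < r / D := by positivity
        generalize r / D = u at hu0 hu1
        have : 1 - (1 + u)⁻¹ = u / (1 + u) := by field_simp; ring
        rw [this]
        exact div_le_div_of_nonneg_left hu0.le (by linarith) (by linarith)
      rw [e]
      linarith
  rcases le_or_gt (k + 1) M with hM | hM
  · refine (main M hM).trans ?_
    have := Real.log_le_log (h.DD_pos (k := k) (N := M) (by omega)) (h.DD_le_Dr hsm (by omega))
    linarith
  · rw [Finset.Ico_eq_empty (by omega), Finset.sum_empty]
    have := Real.log_nonneg (h.one_le_Dr hsm k)
    linarith

lemma Good.moment (h : Good q p1 p2 P K c) (hsm : Summable (ppi q p1 p2 K))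
    {L M x : ℕ} (hL : K + 3 ≤ L) (hx : x < L) {C : ℝ} (hC : 0 ≤ C)
    (hlog : ∀ k, L ≤ k → Real.log (Dr q p1 p2 K k) ≤ C * Real.log k)
    (hS : 1 ≤ ∑ k ∈ Finset.Ico L M, (1 / Real.log k) / Dr q p1 p2 K k) :
    c ^ 6 / (10 + 16 * C) ≤ (P x).real (⋃ k ∈ Finset.Ico L M, ev {k} ∅) := by
  have := h.prob x
  have hK := h.hK
  have hc := h.hc
  have hlog1 : ∀ k, L ≤ k → 1 ≤ Real.log k := by
    intro k hk
    rw [Real.le_log_iff_exp_le (by exact_mod_cast (by omega : 0 < k))]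
    have : (3 : ℝ) ≤ k := by exact_mod_cast (by omega : 3 ≤ k)
    have := Real.exp_one_lt_d9
    linarith
  set w : ℕ → ℝ := fun k => 1 / Real.log k with hw
  set D := Dr q p1 p2 K with hD
  set u : ℕ → ℝ := fun k => w k / D k with hu
  set S := ∑ k ∈ Finset.Ico L M, u k with hSdef
  have hS1 : 1 ≤ S := hS
  have w0 : ∀ k, L ≤ k → 0 < w k := fun k hk => by
    have := hlog1 k hk
    simp only [hw]; positivity
  have w1 : ∀ k, L ≤ k → w k ≤ 1 := fun k hk => by
    have := hlog1 k hk
    simp only [hw]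
    rw [div_le_one (by linarith)]; exact this
  have D1 : ∀ k, 1 ≤ D k := fun k => h.one_le_Dr hsm k
  have u0 : ∀ k, L ≤ k → 0 < u k := fun k hk =>
    div_pos (w0 k hk) (by have := D1 k; linarith)
  have sm := second_moment (P x) (Finset.Ico L M) (fun k => ev {k} ∅)
    (fun k => measurableSet_ev _ _) w
  -- first moment
  have m1 : c ^ 3 * S ≤ ∑ k ∈ Finset.Ico L M, w k * (P x).real (ev {k} ∅) := by
    rw [hSdef, Finset.mul_sum]
    refine Finset.sum_le_sum fun k hk => ?_
    have hk' := Finset.mem_Ico.1 hk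
    have a1 := h.ev_ge (k := k) (by omega) (S := {k}) (V := ∅) (by simp) (by simp)
      (x := x) (by omega)
    have a2 := h.esc_ge hsm (k := k) (by omega)
    have a3 : ppi q p1 p2 K k / (∑' j, ppi q p1 p2 K (k + j)) = 1 / D k := by
      rw [hD, Dr, one_div_div]
    rw [a3] at a2
    have a4 : c ^ 3 * (1 / D k) ≤ (P x).real (ev {k} ∅) :=
      (mul_le_mul_of_nonneg_left a2 (by positivity)).trans a1
    have := mul_le_mul_of_nonneg_left a4 (w0 k hk'.1).le
    refine le_trans (le_of_eq ?_) this
    simp only [hu]; ring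
  -- second moment
  set R : ℕ → ℕ → ℝ := fun k l => (ppi q p1 p2 K l / ppi q p1 p2 K k) / DD q p1 p2 K k l with hR
  set g : ℕ → ℕ → ℝ := fun k l => 4 * u k * u l + if k < l then 4 * u k * w k * R k l else 0
    with hg
  have R0 : ∀ k l, k < l → 0 ≤ R k l := fun k l hkl =>
    (div_pos (div_pos (h.ppi_pos l) (h.ppi_pos k)) (h.DD_pos hkl)).le
  have g0 : ∀ k l, L ≤ k → L ≤ l → 0 ≤ g k l := by
    intro k l hk hl
    have a1 := u0 k hk
    have a2 := u0 l hl
    have a3 := w0 k hk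
    simp only [hg]
    split_ifs with hkl
    · have := R0 k l hkl
      positivity
    · positivity
  have hlt : ∀ k l, L ≤ k → k < l → w k * w l * (P x).real (ev {k} ∅ ∩ ev {l} ∅) ≤ g k l := by
    intro k l hk hkl
    rw [← ev_inter]
    have a1 := h.pair_le (k := k) (l := l) (x := x) (by omega) hkl (by omega)
    have a2 := h.esc_le_Dr hsm (k := l) (by omega)
    have a3 := h.DD_pos hkl
    have a4 := h.Dr_eq hsm hkl.le
    have hDk : 0 < D k := by have := D1 k; linarith
    have hDl : 0 < D l := by have := D1 l; linarith
    have a5 : (P x).real (ev {k, l} ∅) ≤ 2 / D l * (2 / DD q p1 p2 K k l) :=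
      a1.trans (mul_le_mul_of_nonneg_right a2 (by positivity))
    have a6 : 2 / D l * (2 / DD q p1 p2 K k l) = 4 / D k * (1 / D l + R k l) := by
      simp only [hR]
      rw [← hD] at a4
      have hkp := (h.ppi_pos k).ne'
      have e : D k = (DD q p1 p2 K k l * 1 + ppi q p1 p2 K l / ppi q p1 p2 K k * D l) := by
        rw [mul_one]; exact a4
      generalize ppi q p1 p2 K l / ppi q p1 p2 K k = r at *
      generalize DD q p1 p2 K k l = d at *
      have : 1 / D l + r / d = D k / (D l * d) := by
        rw [e]; field_simp
      rw [this]
      field_simp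
      norm_num
    rw [a6] at a5
    have hwl : w l ≤ w k := by
      have := hlog1 k hk
      have hlog' : Real.log k ≤ Real.log l := by
        refine Real.log_le_log ?_ ?_
        · exact_mod_cast (by omega : 0 < k)
        · exact_mod_cast hkl.le
      simp only [hw]
      exact one_div_le_one_div_of_le (by linarith) hlog'
    have hwk := w0 k hk
    have hwl0 := w0 l (by omega)
    have hR0 := R0 k l hkl
    calc w k * w l * (P x).real (ev {k, l} ∅)
        ≤ w k * w l * (4 / D k * (1 / D l + R k l)) :=
          mul_le_mul_of_nonneg_left a5 (by positivity)
      _ = 4 * u k * u l + 4 * u k * w l * R k l := by simp only [hu]; ring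
      _ ≤ 4 * u k * u l + 4 * u k * w k * R k l := by
          have := u0 k hk
          gcongr
      _ = g k l := by simp only [hg, hkl, if_true]
  have hpt : ∀ k ∈ Finset.Ico L M, ∀ l ∈ Finset.Ico L M,
      w k * w l * (P x).real (ev {k} ∅ ∩ ev {l} ∅) ≤
        (g k l + g l k) + if k = l then 2 * u k else 0 := by
    intro k hk l hl
    have hk' := (Finset.mem_Ico.1 hk).1
    have hl' := (Finset.mem_Ico.1 hl).1
    have G1 := g0 k l hk' hl'
    have G2 := g0 l k hl' hk'
    rcases lt_trichotomy k l with hkl | rfl | hkl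
    · have := hlt k l hk' hkl
      rw [if_neg (by omega)]
      linarith
    · rw [if_pos rfl, Set.inter_self]
      have b1 := h.ev_le (k := k) (by omega) (S := {k}) (V := ∅) (by simp) (by simp) (by simp)
        (x := x) (by omega)
      have b2 := b1.trans (h.esc_le_Dr hsm (k := k) (by omega))
      have hwk := w0 k hk'
      have hwk1 := w1 k hk'
      have hDk : 0 < D k := by have := D1 k; linarith
      have : w k * w k * (P x).real (ev {k} ∅) ≤ 2 * u k := by
        calc w k * w k * (P x).real (ev {k} ∅) ≤ w k * 1 * (2 / D k) := by gcongr
          _ = 2 * u k := by simp only [hu]; ring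
      linarith
    · have := hlt l k hl' hkl
      rw [if_neg (by omega), Set.inter_comm]
      linarith [mul_comm (w k) (w l) ▸ this]
  have hgsum : ∑ k ∈ Finset.Ico L M, ∑ l ∈ Finset.Ico L M, g k l ≤ 4 * S ^ 2 + 8 * C * S := by
    have : ∀ k ∈ Finset.Ico L M, ∑ l ∈ Finset.Ico L M, g k l ≤ 4 * u k * S + 8 * C * u k := by
      intro k hk
      have hk' := (Finset.mem_Ico.1 hk).1
      simp only [hg]
      rw [Finset.sum_add_distrib, ← Finset.mul_sum, ← Finset.sum_filter, ← Finset.mul_sum]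
      have e : Finset.filter (fun l => k < l) (Finset.Ico L M) = Finset.Ico (k + 1) M := by
        ext l; simp only [Finset.mem_filter, Finset.mem_Ico]; omega
      rw [e]
      have b1 := h.sum_log hsm (k := k) (by omega) M
      have b2 := hlog k hk'
      have b3 := hlog1 k hk'
      have hu' := u0 k hk'
      have hwk := w0 k hk'
      have b4 : w k * ∑ l ∈ Finset.Ico (k + 1) M, R k l ≤ 2 * C := by
        have : ∑ l ∈ Finset.Ico (k + 1) M, R k l ≤ 2 * C * Real.log k := by
          refine b1.trans ?_
          linarith
        calc w k * ∑ l ∈ Finset.Ico (k + 1) M, R k l ≤ w k * (2 * C * Real.log k) := by gcongr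
          _ = 2 * C := by simp only [hw]; field_simp
      have := mul_le_mul_of_nonneg_left b4 (show 0 ≤ 4 * u k by positivity)
      linarith
    refine (Finset.sum_le_sum this).trans (le_of_eq ?_)
    rw [Finset.sum_add_distrib, ← Finset.sum_mul, ← Finset.mul_sum, ← Finset.mul_sum]
    ring
  have m2 : ∑ k ∈ Finset.Ico L M, ∑ l ∈ Finset.Ico L M,
      w k * w l * (P x).real (ev {k} ∅ ∩ ev {l} ∅) ≤ (10 + 16 * C) * S ^ 2 := by
    refine (Finset.sum_le_sum fun k hk => Finset.sum_le_sum fun l hl => hpt k hk l hl).trans ?_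
    have e1 : ∑ k ∈ Finset.Ico L M, ∑ l ∈ Finset.Ico L M,
        ((g k l + g l k) + if k = l then 2 * u k else 0) =
        2 * (∑ k ∈ Finset.Ico L M, ∑ l ∈ Finset.Ico L M, g k l) + 2 * S := by
      simp only [Finset.sum_add_distrib]
      rw [Finset.sum_comm (f := fun k l => g l k)]
      have : ∑ k ∈ Finset.Ico L M, ∑ l ∈ Finset.Ico L M, (if k = l then 2 * u k else 0) =
          2 * S := by
        rw [hSdef, Finset.mul_sum]
        refine Finset.sum_congr rfl fun k hk => ?_
        rw [Finset.sum_ite_eq, if_pos hk]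
      rw [this]; ring
    rw [e1]
    have : S ≤ S ^ 2 := by nlinarith
    have := mul_le_mul_of_nonneg_left this hC
    nlinarith
  set U := (P x).real (⋃ k ∈ Finset.Ico L M, ev {k} ∅)
  have hU0 : 0 ≤ U := measureReal_nonneg
  rw [div_le_iff₀ (by positivity)]
  have f1 : (c ^ 3 * S) ^ 2 ≤ (10 + 16 * C) * S ^ 2 * U := by
    calc (c ^ 3 * S) ^ 2 ≤ (∑ k ∈ Finset.Ico L M, w k * (P x).real (ev {k} ∅)) ^ 2 := by
          gcongr
      _ ≤ _ := sm
      _ ≤ _ := mul_le_mul_of_nonneg_right m2 hU0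
  have hS2 : 0 < S ^ 2 := by positivity
  have f2 : c ^ 6 * S ^ 2 ≤ (U * (10 + 16 * C)) * S ^ 2 := by
    calc c ^ 6 * S ^ 2 = (c ^ 3 * S) ^ 2 := by ring
      _ ≤ _ := f1
      _ = _ := by ring
  exact le_of_mul_le_mul_right f2 hS2

lemma avoid_set_eq : {ω : ℕ → ℕ | {k : ℕ | ∀ n, ω n ≠ k}.Infinite} =
    ⋂ L : ℕ, ⋃ k ∈ Set.Ici L, ev {k} ∅ := by
  ext ω
  simp only [Set.mem_iInter, Set.mem_iUnion, Set.mem_ofPred_eq]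
  constructor
  · intro hinf L
    obtain ⟨k, hk, hkL⟩ := hinf.exists_gt L
    exact ⟨k, hkL.le, fun n hn => hk n hn, by simp⟩
  · intro hL
    refine Set.infinite_of_forall_exists_gt fun L => ?_
    obtain ⟨k, hkL, hk⟩ := hL (L + 1)
    exact ⟨k, fun n hn => hk.1 n hn, hkL⟩

lemma avoid_inv (t : ℕ) (ω : ℕ → ℕ) :
    (fun i => ω (t + i)) ∈ {ω : ℕ → ℕ | {k : ℕ | ∀ n, ω n ≠ k}.Infinite} ↔
      ω ∈ {ω : ℕ → ℕ | {k : ℕ | ∀ n, ω n ≠ k}.Infinite} := by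
  simp only [Set.mem_ofPred_eq]
  constructor
  · intro hinf
    have hfin : (Set.image ω (Finset.range t : Set ℕ)).Finite := (Finset.finite_toSet _).image _
    refine (hinf.sdiff hfin).mono ?_
    rintro k ⟨h1, h2⟩ n hn
    rcases lt_or_ge n t with hlt | hge
    · exact h2 ⟨n, by simpa using hlt, hn⟩
    · refine h1 (n - t) ?_
      rw [← hn]
      congr 1
      omega
  · intro hinf
    refine hinf.mono ?_
    intro k hk n
    exact hk (t + n)

lemma Good.half2 (h : Good q p1 p2 P K c)
    (hδ : ∃ δ : ℝ, 0 < δ ∧ ∀ᶠ n : ℕ in atTop,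
        DY q p1 p2 n ≤ ENNReal.ofReal (δ * n * Real.log n))
    (hdiv : (∑' n : ℕ,
        (DY q p1 p2 (n + 2) * ENNReal.ofReal (Real.log ((n : ℝ) + 2)))⁻¹) = ⊤) :
    P 2 {ω | {k : ℕ | ∀ n, ω n ≠ k}.Infinite} = 1 := by
  have hK := h.hK
  have hc := h.hc
  obtain ⟨δ, hδ0, hδ⟩ := hδ
  obtain ⟨L1, hL1⟩ := hδ.exists_forall_of_atTop
  have hsm : Summable (ppi q p1 p2 K) :=
    h.summable_of_DY (k := L1 + K) (by omega)
      (ne_top_of_le_ne_top ENNReal.ofReal_ne_top (hL1 (L1 + K) (by omega)))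
  set C := |Real.log δ| + 2 with hC
  have hC0 : 0 ≤ C := by positivity
  set L0 := L1 + K + 3 with hL0
  have hlog : ∀ k, L0 ≤ k → Real.log (Dr q p1 p2 K k) ≤ C * Real.log k := by
    intro k hk
    have a1 := hL1 k (by omega)
    rw [h.DY_eq_Dr hsm (by omega)] at a1
    have hk3 : (3 : ℝ) ≤ k := by exact_mod_cast (by omega : 3 ≤ k)
    have hl1 : 1 ≤ Real.log k := by
      rw [Real.le_log_iff_exp_le (by linarith)]
      have := Real.exp_one_lt_d9
      linarith
    have a2 : Dr q p1 p2 K k ≤ δ * k * Real.log k :=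
      (ENNReal.ofReal_le_ofReal_iff (by positivity)).1 a1
    have a3 : Real.log k ≤ k := (Real.log_le_sub_one_of_pos (by linarith)).trans (by linarith)
    have a4 : Dr q p1 p2 K k ≤ δ * k * k := a2.trans (by gcongr)
    have a5 := Real.log_le_log (by have := h.one_le_Dr hsm k; linarith) a4
    rw [Real.log_mul (by positivity) (by positivity),
      Real.log_mul (by positivity) (by positivity)] at a5
    have a6 := le_abs_self (Real.log δ)
    have a7 := abs_nonneg (Real.log δ)
    rw [hC]
    nlinarith
  have hbig : ∀ L, L0 ≤ L → ∃ M, 1 ≤ ∑ k ∈ Finset.Ico L M, (1 / Real.log k) / Dr q p1 p2 K k := by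
    intro L hL
    by_contra! hcon
    set t : ℕ → ℝ≥0∞ := fun n =>
      (DY q p1 p2 (n + 2) * ENNReal.ofReal (Real.log ((n : ℝ) + 2)))⁻¹ with ht
    have e : ∑' n, t n = ∑ i ∈ Finset.range (L - 2), t i + ∑' n, t (n + (L - 2)) :=
      (Summable.sum_add_tsum_nat_add' ENNReal.summable).symm
    have hfin1 : ∑ i ∈ Finset.range (L - 2), t i ≠ ⊤ := by
      refine (ENNReal.sum_lt_top.2 fun i _ => ?_).ne
      rw [lt_top_iff_ne_top, ht]
      simp only [ne_eq, ENNReal.inv_eq_top]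
      refine mul_ne_zero ?_ ?_
      · have : (1 : ℝ≥0∞) ≤ DY q p1 p2 (i + 2) := le_self_add
        exact (lt_of_lt_of_le zero_lt_one this).ne'
      · have : 0 < Real.log ((i : ℝ) + 2) := Real.log_pos (by
          have : (0 : ℝ) ≤ i := Nat.cast_nonneg i
          linarith)
        simpa using this
    have hfin2 : ∑' n, t (n + (L - 2)) ≤ 1 := by
      refine ENNReal.tsum_le_of_sum_range_le fun n => ?_
      have e2 : ∀ i, t (i + (L - 2)) =
          ENNReal.ofReal ((1 / Real.log ((L + i : ℕ) : ℝ)) / Dr q p1 p2 K (L + i)) := by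
        intro i
        have hlp : 0 < Real.log ((L + i : ℕ) : ℝ) :=
          Real.log_pos (by exact_mod_cast (by omega : 1 < L + i))
        have hD := h.one_le_Dr hsm (L + i)
        have e3 : ((i + (L - 2) : ℕ) : ℝ) + 2 = ((L + i : ℕ) : ℝ) := by
          have : i + (L - 2) + 2 = L + i := by omega
          rw [← this]; push_cast; ring
        simp only [ht]
        rw [e3, show i + (L - 2) + 2 = L + i by omega, h.DY_eq_Dr hsm (by omega),
          ← ENNReal.ofReal_mul (by linarith), ← ENNReal.ofReal_inv_of_pos (by positivity)]
        congr 1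
        field_simp
      simp only [e2]
      rw [← ENNReal.ofReal_sum_of_nonneg]
      · have := hcon (L + n)
        rw [Finset.sum_Ico_eq_sum_range, Nat.add_sub_cancel_left] at this
        rw [← ENNReal.ofReal_one]
        exact ENNReal.ofReal_le_ofReal this.le
      · intro i _
        have hlp : 0 < Real.log ((L + i : ℕ) : ℝ) :=
          Real.log_pos (by exact_mod_cast (by omega : 1 < L + i))
        have hD := h.one_le_Dr hsm (L + i)
        positivity
    have : ∑' n, t n ≠ ⊤ := by
      rw [e]
      exact ENNReal.add_ne_top.2 ⟨hfin1, ne_top_of_le_ne_top ENNReal.one_ne_top hfin2⟩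
    exact this hdiv
  set η := c ^ 6 / (10 + 16 * C) with hη
  have hη0 : 0 < η := by positivity
  have hmeas : ∀ L : ℕ, MeasurableSet (⋃ k ∈ Set.Ici L, ev {k} ∅) := fun L =>
    MeasurableSet.biUnion (Set.to_countable _) fun k _ => measurableSet_ev _ _
  have hunif : ∀ x L, L0 ≤ L → x < L → ENNReal.ofReal η ≤ P x (⋃ k ∈ Set.Ici L, ev {k} ∅) := by
    intro x L hL hx
    have := h.prob x
    obtain ⟨M, hM⟩ := hbig L hL
    have b1 := h.moment hsm (by omega) hx hC0 (fun k hk => hlog k (hL.trans hk)) hM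
    have b2 := ENNReal.ofReal_le_ofReal b1
    rw [measureReal_def, ENNReal.ofReal_toReal (measure_ne_top _ _)] at b2
    refine b2.trans (measure_mono ?_)
    intro ω hω
    simp only [Set.mem_iUnion] at hω ⊢
    obtain ⟨k, hk, hkω⟩ := hω
    exact ⟨k, (Finset.mem_Ico.1 hk).1, hkω⟩
  refine zero_one h.fam _ ?_ avoid_inv η hη0 ?_ 2
  · rw [avoid_set_eq]
    exact MeasurableSet.iInter hmeas
  · intro x
    have := h.prob x
    rw [avoid_set_eq]
    have hanti : Antitone fun L : ℕ => ⋃ k ∈ Set.Ici L, ev {k} ∅ := by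
      intro L L' hLL
      exact Set.biUnion_subset_biUnion_left (Set.Ici_subset_Ici.2 hLL)
    have lim := tendsto_measure_iInter_atTop (μ := P x)
      (fun L => (hmeas L).nullMeasurableSet) hanti ⟨0, measure_ne_top _ _⟩
    refine ge_of_tendsto lim ?_
    filter_upwards [eventually_ge_atTop (L0 + x + 1)] with L hL
    exact hunif x L (by omega) (by omega)
end


theorem cutpoints_Y_finite_or_infinite
    (q p1 p2 : ℕ → ℝ)
    (hq : ∀ k, 2 ≤ k → 0 < q k) (hp1 : ∀ k, 2 ≤ k → 0 ≤ p1 k)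
    (hp2 : ∀ k, 2 ≤ k → 0 < p2 k)
    (hsum : ∀ k, 2 ≤ k → q k + p1 k + p2 k = 1)
    (μ : Measure (ℕ → ℕ)) [IsProbabilityMeasure μ]
    (hμ : IsMarkovChain μ (transY q p1 p2) 2)
    (a b : ℝ) (ha : 0 < a) (hb : 0 < b)
    (hCa : Tendsto (fun k => (p1 k + p2 k) / q k) atTop (𝓝 a))
    (hCb : Tendsto (fun k => p2 k / q k) atTop (𝓝 b))
    (hab : a + b = 1)
    (N₀ : ℕ) (hN₀ : 0 < N₀)
    (hmono : ∀ k l, N₀ ≤ k → k ≤ l → rho q p1 p2 l ≤ rho q p1 p2 k) :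
    ((∑' n : ℕ,
        (DY q p1 p2 (n + 2) * ENNReal.ofReal (Real.log ((n : ℝ) + 2)))⁻¹) ≠ ⊤ →
      μ {ω | {k : ℕ | ∀ n, ω n ≠ k}.Finite} = 1) ∧
    ((∃ δ : ℝ, 0 < δ ∧ ∀ᶠ n : ℕ in atTop,
        DY q p1 p2 n ≤ ENNReal.ofReal (δ * n * Real.log n)) →
      (∑' n : ℕ,
        (DY q p1 p2 (n + 2) * ENNReal.ofReal (Real.log ((n : ℝ) + 2)))⁻¹) = ⊤ →
      μ {ω | {k : ℕ | ∀ n, ω n ≠ k}.Infinite} = 1) := by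
  obtain ⟨P, hP, h2⟩ := exists_family q p1 p2 hq hp2 μ hμ
  obtain ⟨K, c, hG⟩ := exists_good q p1 p2 P ⟨hq, hp1, hp2, hsum, hP⟩ a b ha hb hCa hCb hab N₀ hmono
  rw [← h2]
  exact ⟨fun h => hG.half1 h, fun h h' => hG.half2 h h'⟩


end
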